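/- arXiv:0810.4216 — 2 statements merged into one kernel-verified Lean document; each statement's English description precedes it below -/
import Mathlib

section
/- Let 1 < r < ∞ and let (f_n)_{n≥1} be a sequence of measurable functions on ℝ^d such that (Σ_{n=1}^∞ |f_n(·)|^r)^{1/r} ∈ L^1(μ_κ). Then for every λ > 0, μ_κ({x ∈ ℝ^d : (Σ_{n=1}^∞ |M_κ f_n(x)|^r)^{1/r} > λ}) ≤ (C/λ) ‖(Σ_{n=1}^∞ |f_n(·)|^r)^{1/r}‖_{κ,1}, where C = C(κ_1,…,κ_d,r) is independent of (f_n) and λ. -/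
noncomputable section
open MeasureTheory Set Real
open scoped ENNReal NNReal

/-- one-dimensional measure `dμ_κ(x) = |x|^{2κ} dx` -/
def muK1 (κ : ℝ) : Measure ℝ :=
  volume.withDensity fun x => ENNReal.ofReal (|x| ^ (2 * κ))

/-- the measure `μ_κ` on `ℝ^d` with density `∏_j |x_j|^{2κ_j}` -/
def muK (d : ℕ) (κ : Fin d → ℝ) : Measure (Fin d → ℝ) :=
  volume.withDensity fun x => ENNReal.ofReal (∏ j, |x j| ^ (2 * κ j))

/-- the constant `M_κ = Γ(κ+1/2)/(Γ(κ)Γ(1/2))` -/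
def Mconst (κ : ℝ) : ℝ := Real.Gamma (κ + 1/2) / (Real.Gamma κ * Real.Gamma (1/2))

/-- `σ_{x,y,z}` -/
def sigma3 (x y z : ℝ) : ℝ := if x ≠ 0 ∧ y ≠ 0 then (x^2 + y^2 - z^2) / (2*x*y) else 0

/-- area of the (possibly degenerate) triangle with side lengths `x,y,z` (Heron) -/
def triArea (x y z : ℝ) : ℝ :=
  Real.sqrt (((x+y+z)/2) * ((x+y+z)/2 - x) * ((x+y+z)/2 - y) * ((x+y+z)/2 - z))

/-- the kernel `K_κ(x,y,z)` -/
def Kker (κ x y z : ℝ) : ℝ :=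
  if |x - y| ≤ z ∧ z ≤ x + y then
    (2:ℝ) ^ (2*κ - 2) * Mconst κ * triArea x y z ^ (2*κ - 2) * (x*y*z) ^ (1 - 2*κ)
  else 0

/-- density of the measure `ν^{κ,+}_{x,y}` with respect to Lebesgue measure -/
def nuDens (κ x y z : ℝ) : ℝ≥0∞ :=
  ENNReal.ofReal ((1/2) * Kker κ |x| |y| |z| * (1 - sigma3 x y z) * |z| ^ (2*κ))

/-- the measure `ν^{κ,+}_{x,y}` -/
def nuPlus (κ x y : ℝ) : Measure ℝ := volume.withDensity (nuDens κ x y)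

/-- the product measure `υ^κ_{x,y} = ν^{κ_1,+}_{x_1,y_1} ⊗ ⋯ ⊗ ν^{κ_d,+}_{x_d,y_d}` -/
def upsilon (d : ℕ) (κ x y : Fin d → ℝ) : Measure (Fin d → ℝ) :=
  volume.withDensity fun z => ∏ j, nuDens (κ j) (x j) (y j) (z j)

/-- the set `ℝ^d_reg` of regular points -/
def regSet (d : ℕ) : Set (Fin d → ℝ) := {x | ∀ j, x j ≠ 0}

/-- the Euclidean ball of radius `r` centered at the origin -/
def eBall (d : ℕ) (r : ℝ) : Set (Fin d → ℝ) := {x | ∑ j, (x j)^2 < r^2}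

/-- the open cube `Q_r` -/
def cubeQ (d : ℕ) (r : ℝ) : Set (Fin d → ℝ) := {x | ∀ j, |x j| < r}

/-- the constant `c_κ` with `c_κ⁻¹ = ∫ e^{-‖x‖²/2} dμ_κ` -/
def cKappa (d : ℕ) (κ : Fin d → ℝ) : ℝ :=
  (∫ x, Real.exp (-(∑ j, (x j)^2) / 2) ∂(muK d κ))⁻¹

open Classical in
/-- the `ℤ_2^d` Dunkl maximal operator (explicit form), vanishing off `ℝ^d_reg` -/
def Mdunkl (d : ℕ) (κ : Fin d → ℝ) (f : (Fin d → ℝ) → ℝ) (x : Fin d → ℝ) : ℝ≥0∞ :=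
  if x ∈ regSet d then
    ⨆ (r : ℝ) (_ : 0 < r), ENNReal.ofReal
      ((cKappa d κ / (muK d κ (eBall d r)).toReal) *
        |∫ y in regSet d, f y * (upsilon d κ x (-y) (eBall d r)).toReal ∂(muK d κ)|)
  else 0

/-- the cube Dunkl maximal operator `M_κ^Q` (explicit form) -/
def MdunklQ (d : ℕ) (κ : Fin d → ℝ) (f : (Fin d → ℝ) → ℝ) (x : Fin d → ℝ) : ℝ≥0∞ :=
  ⨆ (r : ℝ) (_ : 0 < r), ENNReal.ofReal
    ((cKappa d κ / (muK d κ (cubeQ d r)).toReal) *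
      |∫ y in regSet d, f y * (upsilon d κ x (-y) (cubeQ d r)).toReal ∂(muK d κ)|)

/-- the interval `I(x,r) = [max{0,|x|-r}, |x|+r)` -/
def Iset (x r : ℝ) : Set ℝ := Set.Ico (max 0 (|x| - r)) (|x| + r)

/-- the rectangle `R(z,r) = I(z_1,r) × ⋯ × I(z_d,r)` -/
def Rset (d : ℕ) (z : Fin d → ℝ) (r : ℝ) : Set (Fin d → ℝ) :=
  Set.univ.pi fun j => Iset (z j) r

/-- the weighted maximal operator `M_κ^R` -/
def MR (d : ℕ) (κ : Fin d → ℝ) (f : (Fin d → ℝ) → ℝ) (x : Fin d → ℝ) : ℝ≥0∞ :=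
  ⨆ (r : ℝ) (_ : 0 < r),
    (muK d κ (Rset d x r))⁻¹ *
      ∫⁻ y in {y | (fun j => |y j|) ∈ Rset d x r}, ENNReal.ofReal |f y| ∂(muK d κ)

/-- Rösler's explicit formula for the one-dimensional Dunkl translation `τ_x^κ f(y)` -/
def tauK (κ x : ℝ) (f : ℝ → ℝ) (y : ℝ) : ℝ :=
  (1/2) * (∫ t in Set.Ioo (-1:ℝ) 1,
      f (Real.sqrt (x^2 + y^2 + 2*x*y*t)) *
        (1 + (x + y) / Real.sqrt (x^2 + y^2 + 2*x*y*t)) *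
        (Mconst κ * (1 + t) * (1 - t^2) ^ (κ - 1)))
  + (1/2) * (∫ t in Set.Ioo (-1:ℝ) 1,
      f (-Real.sqrt (x^2 + y^2 + 2*x*y*t)) *
        (1 - (x + y) / Real.sqrt (x^2 + y^2 + 2*x*y*t)) *
        (Mconst κ * (1 + t) * (1 - t^2) ^ (κ - 1)))

/-- an `ℝ≥0∞`-valued `L^p` norm for `ℝ≥0∞`-valued functions -/
def lpNormE {α : Type*} [MeasurableSpace α] (g : α → ℝ≥0∞) (p : ℝ≥0∞) (μ : Measure α) : ℝ≥0∞ :=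
  if p = ∞ then essSup g μ else (∫⁻ x, g x ^ p.toReal ∂μ) ^ (1 / p.toReal)

/-- the Hardy–Littlewood maximal operator over cubes centered at `x` -/
def HLmax (d : ℕ) (f : (Fin d → ℝ) → ℝ) (x : Fin d → ℝ) : ℝ≥0∞ :=
  ⨆ (r : ℝ) (_ : 0 < r),
    (volume {y : Fin d → ℝ | ∀ j, |y j - x j| < r})⁻¹ *
      ∫⁻ y in {y : Fin d → ℝ | ∀ j, |y j - x j| < r}, ENNReal.ofReal |f y| ∂volume

open Metric Filter Topology

/-- A measure with the global doubling property whose balls have positive, finite measure, the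
measure growing to infinity uniformly with the radius. -/
structure IsGlobDoubling {E : Type*} [PseudoMetricSpace E] [MeasurableSpace E] (μ : Measure E)
    (D : ℝ≥0) : Prop where
  doubling : ∀ x r, 0 < r → μ (closedBall x (2 * r)) ≤ D * μ (closedBall x r)
  pos : ∀ x r, 0 < r → μ (closedBall x r) ≠ 0
  finite : ∀ x r, μ (closedBall x r) ≠ ∞
  growth : ∀ K : ℝ≥0∞, K ≠ ∞ → ∃ R, ∀ x r, 0 < r → μ (closedBall x r) ≤ K → r ≤ R

/-- The uncentered Hardy–Littlewood maximal function of a nonnegative function. -/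
noncomputable def maxFun {E : Type*} [PseudoMetricSpace E] [MeasurableSpace E] (μ : Measure E)
    (f : E → ℝ≥0∞) (x : E) : ℝ≥0∞ :=
  ⨆ (c : E) (r : ℝ) (_ : x ∈ ball c r), (∫⁻ y in closedBall c r, f y ∂μ) / μ (closedBall c r)

section MaxFun

variable {E : Type*} [PseudoMetricSpace E] [MeasurableSpace E] {μ : Measure E} {D : ℝ≥0}

theorem lt_maxFun_iff {f : E → ℝ≥0∞} {x : E} {a : ℝ≥0∞} :
    a < maxFun μ f x ↔ ∃ c r, x ∈ ball c r ∧
      a < (∫⁻ y in closedBall c r, f y ∂μ) / μ (closedBall c r) := by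
  simp only [maxFun, lt_iSup_iff, exists_prop]

theorem average_le_maxFun (f : E → ℝ≥0∞) {x c : E} {r : ℝ} (h : x ∈ ball c r) :
    (∫⁻ y in closedBall c r, f y ∂μ) / μ (closedBall c r) ≤ maxFun μ f x :=
  le_iSup_of_le c <| le_iSup_of_le r <| le_iSup_of_le h le_rfl

theorem maxFun_le {f : E → ℝ≥0∞} {x : E} {a : ℝ≥0∞}
    (h : ∀ c r, x ∈ ball c r → (∫⁻ y in closedBall c r, f y ∂μ) / μ (closedBall c r) ≤ a) :
    maxFun μ f x ≤ a :=
  iSup_le fun c => iSup_le fun r => iSup_le fun hx => h c r hx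

theorem measurable_maxFun [OpensMeasurableSpace E] (f : E → ℝ≥0∞) : Measurable (maxFun μ f) := by
  refine measurable_of_Ioi fun a => IsOpen.measurableSet ?_
  rw [isOpen_iff_forall_mem_open]
  intro x hx
  obtain ⟨c, r, hxc, ha⟩ := lt_maxFun_iff.1 hx
  exact ⟨ball c r, fun y hy => lt_maxFun_iff.2 ⟨c, r, hy, ha⟩, isOpen_ball, hxc⟩

theorem maxFun_mono_ae {f g : E → ℝ≥0∞} (h : f ≤ᵐ[μ] g) (x : E) :
    maxFun μ f x ≤ maxFun μ g x := by
  refine maxFun_le fun c r hx => le_trans ?_ (average_le_maxFun g hx)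
  gcongr ?_ / _
  exact lintegral_mono_ae (ae_restrict_of_ae h)

theorem maxFun_add_le {f g : E → ℝ≥0∞} (hf : Measurable f) (x : E) :
    maxFun μ (fun y => f y + g y) x ≤ maxFun μ f x + maxFun μ g x := by
  refine maxFun_le fun c r hx => ?_
  rw [lintegral_add_left hf, ENNReal.add_div]
  exact add_le_add (average_le_maxFun f hx) (average_le_maxFun g hx)

theorem maxFun_le_of_le_const {f : E → ℝ≥0∞} {a : ℝ≥0∞} (h : ∀ x, f x ≤ a) (x : E) :
    maxFun μ f x ≤ a := by
  refine maxFun_le fun c r hx => ENNReal.div_le_of_le_mul ?_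
  calc _ ≤ ∫⁻ _ in closedBall c r, a ∂μ := lintegral_mono h
    _ = _ := by simp

theorem IsGlobDoubling.doubling_pow (hμ : IsGlobDoubling μ D) (k : ℕ) (x : E) {r : ℝ}
    (hr : 0 < r) : μ (closedBall x (2 ^ k * r)) ≤ (D : ℝ≥0∞) ^ k * μ (closedBall x r) := by
  induction k with
  | zero => simp
  | succ k ih =>
    have := hμ.doubling x (2 ^ k * r) (by positivity)
    rw [pow_succ', mul_assoc, pow_succ', mul_assoc]
    exact this.trans (by gcongr)

/-- Vitali covering lemma for balls of measure bounded by a fixed multiple of the mass of `f`. -/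
theorem IsGlobDoubling.exists_vitali [SecondCountableTopology E] [OpensMeasurableSpace E]
    (hμ : IsGlobDoubling μ D) {f : E → ℝ≥0∞} (hf : ∫⁻ x, f x ∂μ ≠ ∞) {a : ℝ≥0∞} (ha : a ≠ 0)
    (ha' : a ≠ ∞) (t : Set (E × ℝ)) (ht : ∀ p ∈ t, 0 < p.2)
    (h : ∀ p ∈ t, a * μ (closedBall p.1 p.2) ≤ ∫⁻ y in closedBall p.1 p.2, f y ∂μ) :
    ∃ u ⊆ t, u.Countable ∧ (u.PairwiseDisjoint fun p => closedBall p.1 p.2) ∧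
      (∀ p ∈ t, ∃ q ∈ u, closedBall p.1 p.2 ⊆ closedBall q.1 (4 * q.2)) ∧
      ∑' p : u, a * μ (closedBall p.1.1 p.1.2) ≤ ∫⁻ x, f x ∂μ := by
  obtain ⟨R, hR⟩ := hμ.growth ((∫⁻ x, f x ∂μ) / a) (ENNReal.div_ne_top hf ha)
  obtain ⟨u, hut, hdisj, hcov⟩ := Vitali.exists_disjoint_subfamily_covering_enlargement_closedBall
    t Prod.fst Prod.snd R (fun p hp => hR p.1 p.2 (ht p hp) (by
      rw [ENNReal.le_div_iff_mul_le (Or.inl ha) (Or.inl ha'), mul_comm]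
      exact (h p hp).trans (setLIntegral_le_lintegral _ _))) 4 (by norm_num)
  have hc : u.Countable := by
    refine hdisj.countable_of_nonempty_interior fun p hp => ⟨p.1, ?_⟩
    exact ball_subset_interior_closedBall (mem_ball_self (ht p (hut hp)))
  refine ⟨u, hut, hc, hdisj, hcov, ?_⟩
  have : Countable u := hc
  calc ∑' p : u, a * μ (closedBall p.1.1 p.1.2)
      ≤ ∑' p : u, ∫⁻ y in closedBall p.1.1 p.1.2, f y ∂μ :=
        ENNReal.tsum_le_tsum fun p => h p.1 (hut p.2)
    _ = ∫⁻ y in ⋃ p : u, closedBall p.1.1 p.1.2, f y ∂μ := by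
        rw [lintegral_iUnion (fun p => measurableSet_closedBall)]
        exact fun p q hpq => hdisj p.2 q.2 (fun h => hpq (Subtype.ext h))
    _ ≤ _ := setLIntegral_le_lintegral _ _

/-- Weak type `(1,1)` for the maximal function. -/
theorem IsGlobDoubling.weak_type [SecondCountableTopology E] [OpensMeasurableSpace E]
    (hμ : IsGlobDoubling μ D) (f : E → ℝ≥0∞) {a : ℝ≥0∞} (ha : a ≠ 0) (ha' : a ≠ ∞) :
    a * μ {x | a < maxFun μ f x} ≤ (D : ℝ≥0∞) ^ 2 * ∫⁻ x, f x ∂μ := by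
  by_cases hf : ∫⁻ x, f x ∂μ = ∞
  · by_cases hD : D = 0
    · have : IsEmpty E := ⟨fun x => hμ.pos x (2 * 1) (by norm_num) (by
        simpa [hD] using hμ.doubling x 1 one_pos)⟩
      rw [Set.eq_empty_of_isEmpty {x | a < maxFun μ f x}]
      simp
    · rw [hf, ENNReal.mul_top (by simpa using hD)]
      exact le_top
  obtain ⟨u, hut, hc, hdisj, hcov, hsum⟩ := hμ.exists_vitali hf ha ha'
    {p | 0 < p.2 ∧ a * μ (closedBall p.1 p.2) ≤ ∫⁻ y in closedBall p.1 p.2, f y ∂μ}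
    (fun p hp => hp.1) (fun p hp => hp.2)
  have : Countable u := hc
  have hsub : {x | a < maxFun μ f x} ⊆ ⋃ p : u, closedBall p.1.1 (2 ^ 2 * p.1.2) := by
    intro x hx
    obtain ⟨c, r, hxr, h⟩ := lt_maxFun_iff.1 hx
    have hr : 0 < r := pos_of_mem_ball hxr
    have := ENNReal.mul_le_of_le_div h.le
    obtain ⟨q, hq, hq'⟩ := hcov (c, r) ⟨hr, this⟩
    refine mem_iUnion.2 ⟨⟨q, hq⟩, ?_⟩
    norm_num
    exact hq' (ball_subset_closedBall hxr)
  calc a * μ {x | a < maxFun μ f x}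
      ≤ a * ∑' p : u, μ (closedBall p.1.1 (2 ^ 2 * p.1.2)) := by
        gcongr
        exact (measure_mono hsub).trans (measure_iUnion_le _)
    _ ≤ a * ∑' p : u, (D : ℝ≥0∞) ^ 2 * μ (closedBall p.1.1 p.1.2) := by
        gcongr with p
        exact hμ.doubling_pow 2 _ (hut p.2).1
    _ = (D : ℝ≥0∞) ^ 2 * ∑' p : u, a * μ (closedBall p.1.1 p.1.2) := by
        rw [← ENNReal.tsum_mul_left, ← ENNReal.tsum_mul_left]
        exact tsum_congr fun p => by ring
    _ ≤ _ := by gcongr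

theorem IsGlobDoubling.exists_stopping_radius (hμ : IsGlobDoubling μ D) {f : E → ℝ≥0∞}
    (hf : ∫⁻ x, f x ∂μ ≠ ∞) {a : ℝ≥0∞} (ha : a ≠ 0) (ha' : a ≠ ∞) {x : E} {s : ℝ} (hs : 0 < s)
    (h : a * μ (closedBall x s) < ∫⁻ y in closedBall x s, f y ∂μ) :
    ∃ s, 0 < s ∧ a * μ (closedBall x s) ≤ ∫⁻ y in closedBall x s, f y ∂μ ∧
      ∫⁻ y in closedBall x (2 ^ 2 * s), f y ∂μ ≤ a * μ (closedBall x (2 ^ 2 * s)) := by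
  by_contra! hcon
  have hall : ∀ k : ℕ, a * μ (closedBall x ((2 ^ 2) ^ k * s)) <
      ∫⁻ y in closedBall x ((2 ^ 2) ^ k * s), f y ∂μ := by
    intro k
    induction k with
    | zero => simpa using h
    | succ k ih =>
      rw [pow_succ', mul_assoc]
      exact hcon _ (by positivity) ih.le
  obtain ⟨R, hR⟩ := hμ.growth ((∫⁻ x, f x ∂μ) / a) (ENNReal.div_ne_top hf ha)
  obtain ⟨k, hk⟩ := pow_unbounded_of_one_lt (R / s) (show (1 : ℝ) < 2 ^ 2 by norm_num)
  refine absurd (hR x ((2 ^ 2) ^ k * s) (by positivity) ?_) (not_le.2 ((div_lt_iff₀ hs).1 hk))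
  rw [ENNReal.le_div_iff_mul_le (Or.inl ha) (Or.inl ha'), mul_comm]
  exact (hall k).le.trans (setLIntegral_le_lintegral _ _)

theorem IsGlobDoubling.isLocallyFiniteMeasure (hμ : IsGlobDoubling μ D) :
    IsLocallyFiniteMeasure μ :=
  ⟨fun x => ⟨closedBall x 1, closedBall_mem_nhds x one_pos, (hμ.finite x 1).lt_top⟩⟩
/-- Outside the enlarged balls, the maximal function does not distinguish between mass on the
fourfold enlargements and the same mass spread uniformly over the balls. -/
theorem IsGlobDoubling.maxFun_tsum_le [OpensMeasurableSpace E] (hμ : IsGlobDoubling μ D) {u : Set (E × ℝ)}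
    (hu : u.Countable) (hpos : ∀ p ∈ u, 0 < p.2) {f : E → ℝ≥0∞} (hf : Measurable f) {x : E}
    (hx : x ∉ ⋃ p : u, closedBall p.1.1 (2 ^ 3 * p.1.2)) :
    maxFun μ (fun y => ∑' p : u, (closedBall p.1.1 (2 ^ 2 * p.1.2)).indicator f y) x ≤
      (D : ℝ≥0∞) ^ 2 * maxFun μ (fun y => ∑' p : u, (closedBall p.1.1 p.1.2).indicator
        (fun _ => (∫⁻ z in closedBall p.1.1 (2 ^ 2 * p.1.2), f z ∂μ) /
          μ (closedBall p.1.1 p.1.2)) y) x := by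
  have : Countable u := hu
  set g : E → ℝ≥0∞ := fun y => ∑' p : u, (closedBall p.1.1 p.1.2).indicator
        (fun _ => (∫⁻ z in closedBall p.1.1 (2 ^ 2 * p.1.2), f z ∂μ) /
          μ (closedBall p.1.1 p.1.2)) y with hg
  refine maxFun_le fun c s hxs => ?_
  have hs : 0 < s := pos_of_mem_ball hxs
  have hint : ∫⁻ y in closedBall c s, ∑' p : u,
      (closedBall p.1.1 (2 ^ 2 * p.1.2)).indicator f y ∂μ ≤
      ∫⁻ y in closedBall c (2 ^ 2 * s), g y ∂μ := by
    rw [lintegral_tsum (fun p => (hf.indicator measurableSet_closedBall).aemeasurable), hg,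
      lintegral_tsum (fun p => (measurable_const.indicator measurableSet_closedBall).aemeasurable)]
    refine ENNReal.tsum_le_tsum fun p => ?_
    rw [lintegral_indicator measurableSet_closedBall, lintegral_indicator measurableSet_closedBall,
      Measure.restrict_restrict measurableSet_closedBall,
      Measure.restrict_restrict measurableSet_closedBall]
    rcases (closedBall p.1.1 (2 ^ 2 * p.1.2) ∩ closedBall c s).eq_empty_or_nonempty with he | he
    · simp [he]
    · obtain ⟨y, hy1, hy2⟩ := he
      have hxp : x ∉ closedBall p.1.1 (2 ^ 3 * p.1.2) := fun h => hx (mem_iUnion.2 ⟨p, h⟩)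
      rw [mem_closedBall] at hy1 hy2 hxp
      rw [mem_ball] at hxs
      push Not at hxp
      have hxy : dist x y ≤ dist x c + dist y c := dist_triangle_right _ _ _
      have hxp' : dist x p.1.1 ≤ dist x y + dist y p.1.1 := dist_triangle _ _ _
      have hsub : closedBall p.1.1 p.1.2 ⊆ closedBall c (2 ^ 2 * s) := by
        refine closedBall_subset_closedBall' ?_
        have := dist_triangle p.1.1 y c
        rw [dist_comm p.1.1 y] at this
        linarith
      rw [inter_eq_self_of_subset_left hsub, setLIntegral_const,
        ENNReal.div_mul_cancel (hμ.pos _ _ (hpos p p.2)) (hμ.finite _ _)]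
      exact lintegral_mono_set inter_subset_left
  have hxs' : x ∈ ball c (2 ^ 2 * s) := ball_subset_ball (by linarith) hxs
  refine ENNReal.div_le_of_le_mul (hint.trans ?_)
  calc ∫⁻ y in closedBall c (2 ^ 2 * s), g y ∂μ
      = (∫⁻ y in closedBall c (2 ^ 2 * s), g y ∂μ) / μ (closedBall c (2 ^ 2 * s)) *
          μ (closedBall c (2 ^ 2 * s)) := by
        rw [ENNReal.div_mul_cancel (hμ.pos _ _ (by positivity)) (hμ.finite _ _)]
    _ ≤ maxFun μ g x * ((D : ℝ≥0∞) ^ 2 * μ (closedBall c s)) := by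
        gcongr
        · exact average_le_maxFun g hxs'
        · exact hμ.doubling_pow 2 c hs
    _ = _ := by ring

end MaxFun

/-- Power layer-cake identity. -/
theorem lintegral_rpow_sub_one_lt {p : ℝ} (hp : 0 < p) (g : ℝ≥0∞) :
    ∫⁻ t in Ioi (0 : ℝ), {t : ℝ | ENNReal.ofReal t < g}.indicator
      (fun t => ENNReal.ofReal (t ^ (p - 1))) t = ENNReal.ofReal p⁻¹ * g ^ p := by
  have hfin : ∀ G : ℝ, 0 ≤ G → ∫⁻ t in Ioo 0 G, ENNReal.ofReal (t ^ (p - 1)) =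
      ENNReal.ofReal p⁻¹ * ENNReal.ofReal G ^ p := by
    intro G hG
    rw [Measure.restrict_congr_set Ioo_ae_eq_Ioc, ← ofReal_integral_eq_lintegral_ofReal,
      ← intervalIntegral.integral_of_le hG, integral_rpow (Or.inl (by linarith))]
    · rw [ENNReal.ofReal_rpow_of_nonneg hG hp.le, ← ENNReal.ofReal_mul (by positivity)]
      simp [hp.ne', div_eq_inv_mul]
    · exact (intervalIntegrable_iff_integrableOn_Ioc_of_le hG).1
        (intervalIntegral.intervalIntegrable_rpow' (by linarith))
    · filter_upwards [ae_restrict_mem measurableSet_Ioc] with t ht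
      exact rpow_nonneg ht.1.le _
  have hms : MeasurableSet {t : ℝ | ENNReal.ofReal t < g} :=
    measurableSet_lt ENNReal.measurable_ofReal measurable_const
  rw [lintegral_indicator hms, Measure.restrict_restrict hms]
  induction g with
  | top =>
    have h : ∀ G : ℝ, 0 ≤ G → ENNReal.ofReal p⁻¹ * ENNReal.ofReal G ^ p ≤
        ∫⁻ t in {t : ℝ | ENNReal.ofReal t < ∞} ∩ Ioi 0, ENNReal.ofReal (t ^ (p - 1)) := by
      intro G hG
      rw [← hfin G hG]
      exact lintegral_mono_set fun t ht => ⟨ENNReal.ofReal_lt_top, ht.1⟩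
    rw [ENNReal.top_rpow_of_pos hp, ENNReal.mul_top (by simpa using hp)]
    refine ENNReal.eq_top_of_forall_nnreal_le fun b => ?_
    refine le_trans ?_ (h ((p * b) ^ p⁻¹) (by positivity))
    rw [ENNReal.ofReal_rpow_of_nonneg (by positivity) hp.le, ← ENNReal.ofReal_mul (by positivity),
      Real.rpow_inv_rpow (by positivity) hp.ne', inv_mul_cancel_left₀ hp.ne']
    simp
  | coe G =>
    rw [← ENNReal.ofReal_coe_nnreal, ← hfin G G.2]
    congr 2
    ext t
    constructor
    · rintro ⟨h1, h2⟩
      exact ⟨h2, ENNReal.lt_ofReal_iff_toReal_lt (by simp) |>.1 h1 |>.trans_eq' (by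
        rw [ENNReal.toReal_ofReal (le_of_lt h2)])⟩
    · rintro ⟨h1, h2⟩
      exact ⟨(ENNReal.ofReal_lt_ofReal_iff (h1.trans h2)).2 h2, h1⟩

theorem lintegral_rpow_eq_layercake {α : Type*} [MeasurableSpace α] {μ : Measure α} [SFinite μ] {p : ℝ} (hp : 0 < p) {g : α → ℝ≥0∞}
    (hg : Measurable g) {h : α → ℝ≥0∞} (hh : Measurable h) :
    ENNReal.ofReal p⁻¹ * ∫⁻ x, h x * g x ^ p ∂μ =
      ∫⁻ t in Ioi (0 : ℝ), ENNReal.ofReal (t ^ (p - 1)) *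
        ∫⁻ x in {x | ENNReal.ofReal t < g x}, h x ∂μ := by
  have hms : MeasurableSet {q : α × ℝ | ENNReal.ofReal q.2 < g q.1} :=
    measurableSet_lt (by fun_prop) (by fun_prop)
  have hmeas : Measurable (Function.uncurry fun (x : α) (t : ℝ) =>
      h x * {t : ℝ | ENNReal.ofReal t < g x}.indicator
        (fun t => ENNReal.ofReal (t ^ (p - 1))) t) := by
    have : Measurable ({q : α × ℝ | ENNReal.ofReal q.2 < g q.1}.indicator
        (fun q => ENNReal.ofReal (q.2 ^ (p - 1)))) := Measurable.indicator (by fun_prop) hms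
    exact (hh.comp measurable_fst).mul this
  calc ENNReal.ofReal p⁻¹ * ∫⁻ x, h x * g x ^ p ∂μ
      = ∫⁻ x, h x * (∫⁻ t in Ioi (0 : ℝ), {t : ℝ | ENNReal.ofReal t < g x}.indicator
          (fun t => ENNReal.ofReal (t ^ (p - 1))) t) ∂μ := by
        rw [← lintegral_const_mul _ (by fun_prop)]
        refine lintegral_congr fun x => ?_
        rw [lintegral_rpow_sub_one_lt hp]
        ring
    _ = ∫⁻ x, (∫⁻ t in Ioi (0 : ℝ), h x * {t : ℝ | ENNReal.ofReal t < g x}.indicator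
          (fun t => ENNReal.ofReal (t ^ (p - 1))) t) ∂μ := by
        refine lintegral_congr fun x => ?_
        rw [lintegral_const_mul]
        exact Measurable.indicator (by fun_prop) (measurableSet_lt (by fun_prop) (by fun_prop))
    _ = ∫⁻ t in Ioi (0 : ℝ), ∫⁻ x, h x * {t : ℝ | ENNReal.ofReal t < g x}.indicator
      (fun t => ENNReal.ofReal (t ^ (p - 1))) t ∂μ := lintegral_lintegral_swap hmeas.aemeasurable
    _ = _ := by
        refine lintegral_congr fun t => ?_
        rw [← lintegral_const_mul _ hh, ← lintegral_indicator (measurableSet_lt (by fun_prop) hg)]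
        refine lintegral_congr fun x => ?_
        by_cases hx : ENNReal.ofReal t < g x <;> simp [Set.indicator, hx, mul_comm]

section MaxFun

variable {E : Type*} [PseudoMetricSpace E] [MeasurableSpace E] {μ : Measure E} {D : ℝ≥0}

/-- Strong type `(p,p)` for the maximal function, `1 < p`. -/
theorem IsGlobDoubling.strong_type [SecondCountableTopology E] [OpensMeasurableSpace E] [SFinite μ]
    (hμ : IsGlobDoubling μ D) {p : ℝ} (hp : 1 < p) :
    ∃ C : ℝ≥0, ∀ f : E → ℝ≥0∞, Measurable f →
      ∫⁻ x, maxFun μ f x ^ p ∂μ ≤ C * ∫⁻ x, f x ^ p ∂μ := by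
  have hp0 : 0 < p := one_pos.trans hp
  have hp1 : 0 < p - 1 := sub_pos.2 hp
  refine ⟨Real.toNNReal p * (D ^ 2 * 2) * Real.toNNReal ((p - 1)⁻¹) * 2 ^ (p - 1),
    fun f hf => ?_⟩
  have key : ∀ t : ℝ, 0 < t → μ {x | ENNReal.ofReal t < maxFun μ f x} ≤
      ENNReal.ofReal t⁻¹ * ((D ^ 2 * 2 : ℝ≥0) : ℝ≥0∞) *
        ∫⁻ x in {x | ENNReal.ofReal t < 2 * f x}, f x ∂μ := by
    intro t ht
    have ht2 : ENNReal.ofReal (t / 2) ≠ 0 := by simpa using ht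
    have ht3 : ENNReal.ofReal t = ENNReal.ofReal (t / 2) + ENNReal.ofReal (t / 2) := by
      rw [← ENNReal.ofReal_add (by positivity) (by positivity), add_halves]
    have hms : MeasurableSet {x | ENNReal.ofReal t < 2 * f x} :=
      measurableSet_lt (by fun_prop) (by fun_prop)
    set f1 := {x | ENNReal.ofReal t < 2 * f x}.indicator f with hf1
    set f2 := {x | ENNReal.ofReal t < 2 * f x}ᶜ.indicator f with hf2
    have hf12 : f = fun x => f1 x + f2 x := by
      ext x
      exact (congrFun (Set.indicator_self_add_compl {x | ENNReal.ofReal t < 2 * f x} f) x).symm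
    have h2 : ∀ x, f2 x ≤ ENNReal.ofReal (t / 2) := by
      intro x
      refine Set.indicator_apply_le' (fun hx => ?_) (fun _ => zero_le)
      have : 2 * f x ≤ ENNReal.ofReal t := not_lt.1 hx
      rw [ENNReal.ofReal_div_of_pos two_pos, ENNReal.le_div_iff_mul_le (by simp) (by simp)]
      simpa [mul_comm] using this
    have hsub : {x | ENNReal.ofReal t < maxFun μ f x} ⊆
        {x | ENNReal.ofReal (t / 2) < maxFun μ f1 x} := by
      intro x hx
      by_contra hcon
      refine absurd (show maxFun μ f x ≤ ENNReal.ofReal t from ?_) (not_le.2 hx)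
      rw [ht3]
      conv_lhs => rw [hf12]
      exact (maxFun_add_le (hf.indicator hms) x).trans
        (add_le_add (not_lt.1 hcon) (maxFun_le_of_le_const h2 x))
    have hw := hμ.weak_type f1 ht2 ENNReal.ofReal_ne_top
    rw [hf1, lintegral_indicator hms, ← hf1] at hw
    have ht4 : ENNReal.ofReal t⁻¹ * 2 * ENNReal.ofReal (t / 2) = 1 := by
      rw [show (2 : ℝ≥0∞) = ENNReal.ofReal 2 by simp, ← ENNReal.ofReal_mul (by positivity),
        ← ENNReal.ofReal_mul (by positivity)]
      simp; field_simp
    calc μ {x | ENNReal.ofReal t < maxFun μ f x}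
        ≤ μ {x | ENNReal.ofReal (t / 2) < maxFun μ f1 x} := measure_mono hsub
      _ = ENNReal.ofReal t⁻¹ * 2 * (ENNReal.ofReal (t / 2) *
            μ {x | ENNReal.ofReal (t / 2) < maxFun μ f1 x}) := by
          rw [← mul_assoc, ht4, one_mul]
      _ ≤ ENNReal.ofReal t⁻¹ * 2 * ((D : ℝ≥0∞) ^ 2 *
            ∫⁻ x in {x | ENNReal.ofReal t < 2 * f x}, f x ∂μ) := by gcongr
      _ = _ := by push_cast; ring
  have hM : Measurable (maxFun μ f) := measurable_maxFun f
  have e1 := lintegral_rpow_eq_layercake (μ := μ) hp0 hM (measurable_const (a := (1 : ℝ≥0∞)))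
  have e2 := lintegral_rpow_eq_layercake (μ := μ) hp1 (g := fun x => 2 * f x) (by fun_prop) hf
  have h3 : ENNReal.ofReal p * ENNReal.ofReal p⁻¹ = 1 := by
    rw [← ENNReal.ofReal_mul hp0.le]; simp [hp0.ne']
  calc ∫⁻ x, maxFun μ f x ^ p ∂μ
      = ENNReal.ofReal p * (ENNReal.ofReal p⁻¹ * ∫⁻ x, 1 * maxFun μ f x ^ p ∂μ) := by
        rw [← mul_assoc, h3]; simp
    _ = ENNReal.ofReal p * ∫⁻ t in Ioi (0 : ℝ), ENNReal.ofReal (t ^ (p - 1)) *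
          μ {x | ENNReal.ofReal t < maxFun μ f x} := by
        rw [e1]; simp
    _ ≤ ENNReal.ofReal p * ∫⁻ t in Ioi (0 : ℝ), ((D ^ 2 * 2 : ℝ≥0) : ℝ≥0∞) *
          (ENNReal.ofReal (t ^ (p - 1 - 1)) *
            ∫⁻ x in {x | ENNReal.ofReal t < 2 * f x}, f x ∂μ) := by
        gcongr ENNReal.ofReal p * ?_
        refine setLIntegral_mono' measurableSet_Ioi fun t (ht : 0 < t) => ?_
        calc _ ≤ ENNReal.ofReal (t ^ (p - 1)) * (ENNReal.ofReal t⁻¹ * ((D ^ 2 * 2 : ℝ≥0) : ℝ≥0∞) *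
                ∫⁻ x in {x | ENNReal.ofReal t < 2 * f x}, f x ∂μ) := by
              gcongr; exact key t ht
          _ = ((D ^ 2 * 2 : ℝ≥0) : ℝ≥0∞) * ((ENNReal.ofReal (t ^ (p - 1)) * ENNReal.ofReal t⁻¹) *
                ∫⁻ x in {x | ENNReal.ofReal t < 2 * f x}, f x ∂μ) := by ring
          _ = _ := by
              rw [← ENNReal.ofReal_mul (by positivity), Real.rpow_sub_one ht.ne' (p - 1),
                div_eq_mul_inv]
    _ = ENNReal.ofReal p * (((D ^ 2 * 2 : ℝ≥0) : ℝ≥0∞) * (ENNReal.ofReal (p - 1)⁻¹ *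
          ∫⁻ x, f x * (2 * f x) ^ (p - 1) ∂μ)) := by
        rw [lintegral_const_mul' _ _ ENNReal.coe_ne_top, ← e2]
    _ = ENNReal.ofReal p * (((D ^ 2 * 2 : ℝ≥0) : ℝ≥0∞) * (ENNReal.ofReal (p - 1)⁻¹ *
          ∫⁻ x, 2 ^ (p - 1) * f x ^ p ∂μ)) := by
        congr 3
        refine lintegral_congr fun x => ?_
        rw [ENNReal.mul_rpow_of_nonneg _ _ hp1.le, mul_left_comm]
        congr 1
        nth_rewrite 1 [← ENNReal.rpow_one (f x)]
        rw [← ENNReal.rpow_add_of_nonneg _ _ zero_le_one hp1.le]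
        congr 1; ring
    _ = _ := by
        rw [lintegral_const_mul _ (by fun_prop)]
        push_cast [ENNReal.ofReal]
        rw [ENNReal.coe_rpow_of_nonneg _ hp1.le]
        push_cast
        ring

end MaxFun

/-- Minkowski's integral inequality in `ℓ^r`. -/
theorem tsum_lintegral_rpow_le {α : Type*} [MeasurableSpace α] {ν : Measure α} {r : ℝ} (hr : 1 < r)
    {f : ℕ → α → ℝ≥0∞} (hf : ∀ n, Measurable (f n)) :
    ∑' n, (∫⁻ x, f n x ∂ν) ^ r ≤ (∫⁻ x, (∑' n, f n x ^ r) ^ (1 / r) ∂ν) ^ r := by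
  have hr0 : 0 < r := one_pos.trans hr
  set F : α → ℝ≥0∞ := fun x => (∑' n, f n x ^ r) ^ (1 / r) with hF
  by_cases hI : ∫⁻ x, F x ∂ν = ∞
  · rw [hI, ENNReal.top_rpow_of_pos hr0]; exact le_top
  set c : ℕ → ℝ≥0∞ := fun n => ∫⁻ x, f n x ∂ν with hc
  have hfF : ∀ n x, f n x ≤ F x := by
    intro n x
    rw [hF, one_div, ENNReal.le_rpow_inv_iff hr0]
    exact ENNReal.le_tsum n
  have hcfin : ∀ n, c n ≠ ∞ := fun n => ne_top_of_le_ne_top hI (lintegral_mono (hfF n))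
  rw [ENNReal.tsum_eq_iSup_sum]
  refine iSup_le fun s => ?_
  set S := ∑ n ∈ s, c n ^ r with hS
  have hSfin : S ≠ ∞ := by
    rw [hS]
    exact (ENNReal.sum_lt_top.2 fun n _ => ENNReal.rpow_lt_top_of_nonneg hr0.le (hcfin n)).ne
  have hpq : r.HolderConjugate (r / (r - 1)) := Real.HolderConjugate.conjExponent hr
  by_cases hS0 : S = 0
  · rw [hS0]; exact zero_le
  have hsplit : ∀ a : ℝ≥0∞, a ^ r = a * a ^ (r - 1) := by
    intro a
    nth_rewrite 2 [← ENNReal.rpow_one a]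
    rw [← ENNReal.rpow_add_of_nonneg _ _ zero_le_one (by linarith)]
    congr 1; ring
  have hle : S ≤ (∫⁻ x, F x ∂ν) * S ^ (1 / (r / (r - 1))) := by
    calc S = ∑ n ∈ s, ∫⁻ x, f n x * c n ^ (r - 1) ∂ν := by
          refine Finset.sum_congr rfl fun n _ => ?_
          rw [lintegral_mul_const _ (hf n), hsplit]
      _ = ∫⁻ x, ∑ n ∈ s, f n x * c n ^ (r - 1) ∂ν := by
          rw [lintegral_finsetSum _ (fun n _ => (hf n).mul_const _)]
      _ ≤ ∫⁻ x, F x * S ^ (1 / (r / (r - 1))) ∂ν := by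
          refine lintegral_mono fun x => ?_
          refine (ENNReal.inner_le_Lp_mul_Lq s _ _ hpq).trans ?_
          gcongr with n hn
          · exact ENNReal.rpow_le_rpow (ENNReal.sum_le_tsum s) (by positivity)
          · refine le_of_eq (Finset.sum_congr rfl fun n _ => ?_)
            rw [← ENNReal.rpow_mul, mul_div_cancel₀ _ (sub_pos.2 hr).ne']
      _ = _ := lintegral_mul_const' _ _ (ENNReal.rpow_ne_top_of_nonneg
            (by have := sub_pos.2 hr; positivity) hSfin)
  have hsum : 1 / r + 1 / (r / (r - 1)) = 1 := by
    field_simp [(sub_pos.2 hr).ne']; ring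
  have hSr : S ^ (1 / r) ≤ ∫⁻ x, F x ∂ν := by
    have h1 : S = S ^ (1 / r) * S ^ (1 / (r / (r - 1))) := by
      rw [← ENNReal.rpow_add _ _ hS0 hSfin, hsum, ENNReal.rpow_one]
    nth_rewrite 1 [h1] at hle
    refine (ENNReal.mul_le_mul_iff_left ?_ ?_).1 hle
    · simp [hS0, hSfin]
    · exact ENNReal.rpow_ne_top_of_nonneg (by have := sub_pos.2 hr; positivity) hSfin
  rwa [one_div, ENNReal.rpow_inv_le_iff hr0] at hSr

theorem tsum_indicator_const_rpow {α ι : Type*} {s : ι → Set α}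
    (hs : Pairwise fun i j => Disjoint (s i) (s j)) (c : ι → ℝ≥0∞) {r : ℝ} (hr : 0 < r) (x : α) :
    (∑' i, (s i).indicator (fun _ => c i) x) ^ r = ∑' i, (s i).indicator (fun _ => c i ^ r) x := by
  by_cases hx : ∃ i, x ∈ s i
  · obtain ⟨i, hi⟩ := hx
    have hne : ∀ j, j ≠ i → x ∉ s j := fun j hj hxj =>
      Set.disjoint_left.1 (hs hj) hxj hi
    rw [tsum_eq_single i (fun j hj => indicator_of_notMem (hne j hj) _),
      tsum_eq_single i (fun j hj => indicator_of_notMem (hne j hj) _),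
      indicator_of_mem hi, indicator_of_mem hi]
  · push Not at hx
    simp [hx, hr]

section VectorValued

variable {E : Type*} [NormedAddCommGroup E] [NormedSpace ℝ E] [FiniteDimensional ℝ E]
  [MeasurableSpace E] [BorelSpace E] {μ : Measure E} {D : ℝ≥0}

theorem IsGlobDoubling.ae_exists_stopping_radius (hμ : IsGlobDoubling μ D) {f : E → ℝ≥0∞}
    (hfm : Measurable f) (hf : ∫⁻ x, f x ∂μ ≠ ∞) {a : ℝ≥0∞} (ha : a ≠ 0) (ha' : a ≠ ∞) :
    ∀ᵐ x ∂μ, a < f x →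
      ∃ s, 0 < s ∧ a * μ (closedBall x s) ≤ ∫⁻ y in closedBall x s, f y ∂μ ∧
      ∫⁻ y in closedBall x (2 ^ 2 * s), f y ∂μ ≤ a * μ (closedBall x (2 ^ 2 * s)) := by
  have := hμ.isLocallyFiniteMeasure
  filter_upwards [(Besicovitch.vitaliFamily μ).ae_tendsto_lintegral_div' hfm hf] with x hx hax
  have h1 := (hx.comp (Besicovitch.tendsto_filterAt μ x)).eventually (lt_mem_nhds hax)
  obtain ⟨s, hs, hs0⟩ := (h1.and self_mem_nhdsWithin).exists
  refine hμ.exists_stopping_radius hf ha ha' hs0 ?_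
  exact (ENNReal.lt_div_iff_mul_lt (Or.inl (hμ.pos x s hs0)) (Or.inl (hμ.finite x s))).1 hs

/-- The vector-valued Fefferman–Stein weak type `(1,1)` inequality for a doubling measure. -/
theorem IsGlobDoubling.vector_weak_type (hμ : IsGlobDoubling μ D) {r : ℝ} (hr : 1 < r) :
    ∃ C : ℝ≥0, ∀ f : ℕ → E → ℝ≥0∞, (∀ n, Measurable (f n)) →
      ∫⁻ x, (∑' n, f n x ^ r) ^ (1 / r) ∂μ ≠ ∞ → ∀ a : ℝ≥0∞, a ≠ 0 → a ≠ ∞ →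
      a * μ {x | a ^ r < ∑' n, maxFun μ (f n) x ^ r} ≤
        C * ∫⁻ x, (∑' n, f n x ^ r) ^ (1 / r) ∂μ := by
  have := hμ.isLocallyFiniteMeasure
  have hr0 : 0 < r := one_pos.trans hr
  obtain ⟨C, hC⟩ := hμ.strong_type hr
  refine ⟨D ^ 3 + 2 ^ (r - 1) * (C + (D ^ 2) ^ r * (C * (D ^ 2) ^ r)), fun f hf hI a ha ha' => ?_⟩
  set F : E → ℝ≥0∞ := fun x => (∑' n, f n x ^ r) ^ (1 / r) with hF
  have hFm : Measurable F := by
    have : Measurable fun x => ∑' n, f n x ^ r :=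
      Measurable.tsum fun n => (hf n).pow_const r
    exact this.pow_const _
  obtain ⟨u, hut, hu, hdisj, hcov, hsum⟩ := hμ.exists_vitali hI ha ha'
    {p | 0 < p.2 ∧ a * μ (closedBall p.1 p.2) ≤ ∫⁻ y in closedBall p.1 p.2, F y ∂μ ∧
      ∫⁻ y in closedBall p.1 (2 ^ 2 * p.2), F y ∂μ ≤ a * μ (closedBall p.1 (2 ^ 2 * p.2))}
    (fun p hp => hp.1) (fun p hp => hp.2.1)
  have : Countable u := hu
  have hpos : ∀ p ∈ u, 0 < p.2 := fun p hp => (hut hp).1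
  have hdisj' : Pairwise fun p q : u => Disjoint (closedBall p.1.1 p.1.2)
      (closedBall q.1.1 q.1.2) :=
    fun p q hpq => hdisj p.2 q.2 (fun h => hpq (Subtype.ext h))
  set W : Set E := ⋃ p : u, closedBall p.1.1 (2 ^ 3 * p.1.2) with hW
  set b : ℕ → E → ℝ≥0∞ := fun n y =>
    ∑' p : u, (closedBall p.1.1 (2 ^ 2 * p.1.2)).indicator (f n) y with hb
  set c : ℕ → u → ℝ≥0∞ := fun n p => (∫⁻ z in closedBall p.1.1 (2 ^ 2 * p.1.2), f n z ∂μ) /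
          μ (closedBall p.1.1 p.1.2) with hc
  set g : ℕ → E → ℝ≥0∞ := fun n y =>
    ∑' p : u, (closedBall p.1.1 p.1.2).indicator (fun _ => c n p) y with hg
  set h : ℕ → E → ℝ≥0∞ := fun n => {x | F x ≤ a}.indicator (f n) with hh
  have hFa : MeasurableSet {x | F x ≤ a} := measurableSet_le hFm measurable_const
  have hhm : ∀ n, Measurable (h n) := fun n => (hf n).indicator hFa
  have hgm : ∀ n, Measurable (g n) := fun n =>
    Measurable.tsum fun p => measurable_const.indicator measurableSet_closedBall
  have hWμ : a * μ W ≤ (D : ℝ≥0∞) ^ 3 * ∫⁻ x, F x ∂μ := by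
    calc a * μ W ≤ a * ∑' p : u, (D : ℝ≥0∞) ^ 3 * μ (closedBall p.1.1 p.1.2) := by
          gcongr
          exact (measure_iUnion_le _).trans (ENNReal.tsum_le_tsum fun p =>
            hμ.doubling_pow 3 _ (hpos p p.2))
      _ = (D : ℝ≥0∞) ^ 3 * ∑' p : u, a * μ (closedBall p.1.1 p.1.2) := by
          rw [← ENNReal.tsum_mul_left, ← ENNReal.tsum_mul_left]
          exact tsum_congr fun p => by ring
      _ ≤ _ := by gcongr
  have hfhb : ∀ n, f n ≤ᵐ[μ] fun x => h n x + b n x := by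
    intro n
    filter_upwards [hμ.ae_exists_stopping_radius hFm hI ha ha'] with x hx
    by_cases hFx : F x ≤ a
    · exact le_add_right (by rw [hh]; exact (indicator_of_mem (show x ∈ {x | F x ≤ a} from hFx) _).ge)
    · obtain ⟨s, hs, hs1, hs2⟩ := hx (not_le.1 hFx)
      obtain ⟨q, hq, hq'⟩ := hcov (x, s) ⟨hs, hs1, hs2⟩
      have hxq : x ∈ closedBall q.1 (2 ^ 2 * q.2) := by
        norm_num
        exact hq' (mem_closedBall_self hs.le)
      refine le_add_left (le_trans ?_ (ENNReal.le_tsum ⟨q, hq⟩))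
      exact (indicator_of_mem hxq _).ge
  have hpt : ∀ x, x ∉ W → ∀ n, maxFun μ (f n) x ^ r ≤
      2 ^ (r - 1) * (maxFun μ (h n) x ^ r + ((D : ℝ≥0∞) ^ 2) ^ r * maxFun μ (g n) x ^ r) := by
    intro x hx n
    have h1 : maxFun μ (f n) x ≤ maxFun μ (h n) x + (D : ℝ≥0∞) ^ 2 * maxFun μ (g n) x :=
      (maxFun_mono_ae (hfhb n) x).trans ((maxFun_add_le (hhm n) x).trans
        (add_le_add le_rfl (hμ.maxFun_tsum_le hu hpos (hf n) hx)))
    refine (ENNReal.rpow_le_rpow h1 hr0.le).trans ?_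
    rw [← ENNReal.mul_rpow_of_nonneg _ _ hr0.le]
    exact ENNReal.rpow_add_le_mul_rpow_add_rpow _ _ hr.le
  have hhr : ∑' n, ∫⁻ x, h n x ^ r ∂μ ≤ a ^ (r - 1) * ∫⁻ x, F x ∂μ := by
    rw [← lintegral_tsum fun n => ((hhm n).pow_const r).aemeasurable, ← lintegral_const_mul _ hFm]
    refine lintegral_mono fun x => ?_
    by_cases hx : F x ≤ a
    · have hx' : x ∈ {x | F x ≤ a} := hx
      simp only [hh, indicator_of_mem hx']
      have hFr : ∑' n, f n x ^ r = F x ^ r := by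
        simp only [hF, one_div]
        rw [ENNReal.rpow_inv_rpow hr0.ne']
      have hFr' : F x ^ r = F x ^ (r - 1) * F x := by
        conv_rhs => rw [← ENNReal.rpow_one (F x), ← ENNReal.rpow_mul, one_mul,
          ← ENNReal.rpow_add_of_nonneg _ _ (by linarith) zero_le_one, sub_add_cancel]
      rw [hFr, hFr']
      gcongr
    · have hx' : x ∉ {x | F x ≤ a} := hx
      simp [hh, indicator_of_notMem hx', hr0]
  have hcr : ∀ p, ∑' n, c n p ^ r ≤ (a * (D : ℝ≥0∞) ^ 2) ^ r := by
    intro p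
    have h1 := tsum_lintegral_rpow_le (ν := μ.restrict (closedBall p.1.1 (2 ^ 2 * p.1.2))) hr hf
    have h2 : (∫⁻ x in closedBall p.1.1 (2 ^ 2 * p.1.2), F x ∂μ) / μ (closedBall p.1.1 p.1.2) ≤
        a * (D : ℝ≥0∞) ^ 2 := by
      refine ENNReal.div_le_of_le_mul ((hut p.2).2.2.trans ?_)
      rw [mul_assoc]
      gcongr
      exact hμ.doubling_pow 2 _ (hpos p p.2)
    refine le_trans ?_ (ENNReal.rpow_le_rpow h2 hr0.le)
    simp only [hc, div_eq_mul_inv, ENNReal.mul_rpow_of_nonneg _ _ hr0.le]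
    rw [ENNReal.tsum_mul_right]
    gcongr
  have hgr : ∑' n, ∫⁻ x, g n x ^ r ∂μ ≤ a ^ (r - 1) * (((D : ℝ≥0∞) ^ 2) ^ r * ∫⁻ x, F x ∂μ) := by
    calc ∑' n, ∫⁻ x, g n x ^ r ∂μ = ∑' n, ∑' p : u, c n p ^ r * μ (closedBall p.1.1 p.1.2) := by
          refine tsum_congr fun n => ?_
          simp only [hg, tsum_indicator_const_rpow hdisj' _ hr0]
          rw [lintegral_tsum fun p =>
            (measurable_const.indicator measurableSet_closedBall).aemeasurable]
          refine tsum_congr fun p => ?_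
          rw [lintegral_indicator measurableSet_closedBall, setLIntegral_const]
      _ = ∑' p : u, (∑' n, c n p ^ r) * μ (closedBall p.1.1 p.1.2) := by
          rw [ENNReal.tsum_comm]
          exact tsum_congr fun p => ENNReal.tsum_mul_right
      _ ≤ ∑' p : u, (a * (D : ℝ≥0∞) ^ 2) ^ r * μ (closedBall p.1.1 p.1.2) := by
          gcongr with p
          exact hcr p
      _ = a ^ (r - 1) * (((D : ℝ≥0∞) ^ 2) ^ r * ∑' p : u, a * μ (closedBall p.1.1 p.1.2)) := by
          rw [← ENNReal.tsum_mul_left, ← ENNReal.tsum_mul_left]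
          refine tsum_congr fun p => ?_
          rw [ENNReal.mul_rpow_of_nonneg _ _ hr0.le]
          have : a ^ r = a ^ (r - 1) * a := by
            conv_rhs => rw [← ENNReal.rpow_one a, ← ENNReal.rpow_mul, one_mul,
              ← ENNReal.rpow_add_of_nonneg _ _ (by linarith) zero_le_one, sub_add_cancel]
          rw [this]; ring
      _ ≤ _ := by gcongr
  set G : E → ℝ≥0∞ := fun x => ∑' n, 2 ^ (r - 1) * (maxFun μ (h n) x ^ r +
      ((D : ℝ≥0∞) ^ 2) ^ r * maxFun μ (g n) x ^ r) with hG
  have hMm : ∀ k : E → ℝ≥0∞, Measurable fun x => maxFun μ k x ^ r :=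
    fun k => (measurable_maxFun k).pow_const r
  have hGt : ∀ n, Measurable fun x => 2 ^ (r - 1) * (maxFun μ (h n) x ^ r +
      ((D : ℝ≥0∞) ^ 2) ^ r * maxFun μ (g n) x ^ r) := fun n =>
    ((hMm _).add ((hMm _).const_mul _)).const_mul _
  have hGm : Measurable G := Measurable.tsum hGt
  have hGI : ∫⁻ x, G x ∂μ ≤ a ^ (r - 1) * (2 ^ (r - 1) * (C * ∫⁻ x, F x ∂μ +
      ((D : ℝ≥0∞) ^ 2) ^ r * (C * (((D : ℝ≥0∞) ^ 2) ^ r * ∫⁻ x, F x ∂μ)))) := by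
    calc ∫⁻ x, G x ∂μ = ∑' n, 2 ^ (r - 1) * (∫⁻ x, maxFun μ (h n) x ^ r ∂μ +
            ((D : ℝ≥0∞) ^ 2) ^ r * ∫⁻ x, maxFun μ (g n) x ^ r ∂μ) := by
          rw [hG, lintegral_tsum fun n => (hGt n).aemeasurable]
          refine tsum_congr fun n => ?_
          have hsum : Measurable fun x => maxFun μ (h n) x ^ r +
              ((D : ℝ≥0∞) ^ 2) ^ r * maxFun μ (g n) x ^ r := (hMm _).add ((hMm _).const_mul _)
          rw [lintegral_const_mul _ hsum, lintegral_add_left (hMm _), lintegral_const_mul _ (hMm _)]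
      _ ≤ ∑' n, 2 ^ (r - 1) * (C * ∫⁻ x, h n x ^ r ∂μ +
            ((D : ℝ≥0∞) ^ 2) ^ r * (C * ∫⁻ x, g n x ^ r ∂μ)) := by
          gcongr with n
          · exact hC _ (hhm n)
          · exact hC _ (hgm n)
      _ = 2 ^ (r - 1) * (C * ∑' n, ∫⁻ x, h n x ^ r ∂μ +
            ((D : ℝ≥0∞) ^ 2) ^ r * (C * ∑' n, ∫⁻ x, g n x ^ r ∂μ)) := by
          rw [ENNReal.tsum_mul_left, ENNReal.tsum_add, ENNReal.tsum_mul_left,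
            ENNReal.tsum_mul_left, ENNReal.tsum_mul_left]
      _ ≤ 2 ^ (r - 1) * (C * (a ^ (r - 1) * ∫⁻ x, F x ∂μ) + ((D : ℝ≥0∞) ^ 2) ^ r *
            (C * (a ^ (r - 1) * (((D : ℝ≥0∞) ^ 2) ^ r * ∫⁻ x, F x ∂μ)))) := by gcongr
      _ = _ := by ring
  have hsub : {x | a ^ r < ∑' n, maxFun μ (f n) x ^ r} ⊆ W ∪ {x | a ^ r ≤ G x} := by
    intro x hx
    by_cases hxW : x ∈ W
    · exact Or.inl hxW
    · exact Or.inr (hx.le.trans (ENNReal.tsum_le_tsum fun n => hpt x hxW n))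
  have hcheb : a * μ {x | a ^ r ≤ G x} ≤ 2 ^ (r - 1) * (C * ∫⁻ x, F x ∂μ +
      ((D : ℝ≥0∞) ^ 2) ^ r * (C * (((D : ℝ≥0∞) ^ 2) ^ r * ∫⁻ x, F x ∂μ))) := by
    have h1 := (mul_meas_ge_le_lintegral (μ := μ) hGm (a ^ r)).trans hGI
    have : a ^ r = a ^ (r - 1) * a := by
      conv_rhs => rw [← ENNReal.rpow_one a, ← ENNReal.rpow_mul, one_mul,
        ← ENNReal.rpow_add_of_nonneg _ _ (by linarith) zero_le_one, sub_add_cancel]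
    nth_rewrite 1 [this] at h1
    rw [mul_assoc] at h1
    exact (ENNReal.mul_le_mul_iff_right (by simp [ha, ha'])
      (ENNReal.rpow_ne_top_of_nonneg (by linarith) ha')).1 h1
  calc a * μ {x | a ^ r < ∑' n, maxFun μ (f n) x ^ r}
      ≤ a * (μ W + μ {x | a ^ r ≤ G x}) := by
        gcongr
        exact (measure_mono hsub).trans (measure_union_le _ _)
    _ ≤ (D : ℝ≥0∞) ^ 3 * ∫⁻ x, F x ∂μ + 2 ^ (r - 1) * (C * ∫⁻ x, F x ∂μ +
          ((D : ℝ≥0∞) ^ 2) ^ r * (C * (((D : ℝ≥0∞) ^ 2) ^ r * ∫⁻ x, F x ∂μ))) := by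
        rw [mul_add]
        exact add_le_add hWμ hcheb
    _ = _ := by
        push_cast [ENNReal.coe_rpow_of_nonneg _ hr0.le,
          ENNReal.coe_rpow_of_nonneg _ (sub_pos.2 hr).le]
        ring

end VectorValued

theorem lintegral_pi_prod {d : ℕ} {g : Fin d → ℝ → ℝ≥0∞} (hg : ∀ j, Measurable (g j)) :
    ∫⁻ x : Fin d → ℝ, ∏ j, g j (x j) = ∏ j, ∫⁻ t, g j t := by
  induction d with
  | zero => simp [volume_pi]
  | succ n ih =>
    have hm : Measurable fun p : ℝ × (Fin n → ℝ) => g 0 p.1 * ∏ j : Fin n, g j.succ (p.2 j) :=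
      ((hg 0).comp measurable_fst).mul (Finset.measurable_prod _ fun j _ =>
        (hg j.succ).comp ((measurable_pi_apply j).comp measurable_snd))
    have h := (volume_preserving_piFinSuccAbove (fun _ : Fin (n + 1) => ℝ) 0).lintegral_comp hm
    simp only [MeasurableEquiv.piFinSuccAbove_apply, Fin.insertNthEquiv_symm_apply,
      Fin.removeNth_apply, Fin.zero_succAbove] at h
    simp only [Fin.prod_univ_succ]
    rw [h, ← ih fun j => hg j.succ]
    exact lintegral_prod_mul (hg 0).aemeasurable (Finset.measurable_prod _ fun (j : Fin n) _ =>
      (hg j.succ).comp (measurable_pi_apply j)).aemeasurable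

theorem setLIntegral_pi_prod {d : ℕ} {g : Fin d → ℝ → ℝ≥0∞} (hg : ∀ j, Measurable (g j))
    {s : Fin d → Set ℝ} (hs : ∀ j, MeasurableSet (s j)) :
    ∫⁻ x in univ.pi s, ∏ j, g j (x j) = ∏ j, ∫⁻ t in s j, g j t := by
  simp only [← lintegral_indicator (hs _)]
  rw [← lintegral_pi_prod fun j => (hg j).indicator (hs j),
    ← lintegral_indicator (MeasurableSet.univ_pi hs)]
  refine lintegral_congr fun x => ?_
  by_cases hx : x ∈ univ.pi s
  · rw [indicator_of_mem hx]
    exact Finset.prod_congr rfl fun j _ => (indicator_of_mem (hx j (mem_univ j)) _).symm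
  · rw [indicator_of_notMem hx]
    obtain ⟨j, hj⟩ : ∃ j, x j ∉ s j := by simpa [mem_univ_pi] using hx
    exact (Finset.prod_eq_zero (Finset.mem_univ j) (indicator_of_notMem hj _)).symm

theorem muK1_apply (κ : ℝ) {s : Set ℝ} (hs : MeasurableSet s) :
    muK1 κ s = ∫⁻ t in s, ENNReal.ofReal (|t| ^ (2 * κ)) :=
  withDensity_apply _ hs

theorem muK_pi (d : ℕ) (κ : Fin d → ℝ) {s : Fin d → Set ℝ} (hs : ∀ j, MeasurableSet (s j)) :
    muK d κ (univ.pi s) = ∏ j, muK1 (κ j) (s j) := by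
  simp only [muK1_apply _ (hs _)]
  rw [muK, withDensity_apply _ (MeasurableSet.univ_pi hs), ← setLIntegral_pi_prod _ hs]
  · simp only [ENNReal.ofReal_prod_of_nonneg fun j _ => Real.rpow_nonneg (abs_nonneg _) _]
  · intro j
    fun_prop

theorem muK1_closedBall_le {κ : ℝ} (hκ : 0 < κ) (x r : ℝ) (hr : 0 < r) :
    muK1 κ (closedBall x r) ≤ ENNReal.ofReal (2 * (r * (|x| + r) ^ (2 * κ))) := by
  rw [muK1_apply _ measurableSet_closedBall]
  calc ∫⁻ t in closedBall x r, ENNReal.ofReal (|t| ^ (2 * κ))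
      ≤ ∫⁻ t in closedBall x r, ENNReal.ofReal ((|x| + r) ^ (2 * κ)) := by
        refine setLIntegral_mono' measurableSet_closedBall fun t ht => ?_
        gcongr
        rw [mem_closedBall, Real.dist_eq] at ht
        linarith [abs_sub_abs_le_abs_sub t x]
    _ = _ := by
        rw [setLIntegral_const, Real.volume_closedBall, ← ENNReal.ofReal_mul (by positivity)]
        congr 1; ring

theorem le_muK1_closedBall {κ : ℝ} (hκ : 0 < κ) (x r : ℝ) (hr : 0 < r) :
    ENNReal.ofReal (2⁻¹ ^ (1 + 2 * κ) * (r * (|x| + r) ^ (2 * κ))) ≤ muK1 κ (closedBall x r) := by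
  obtain ⟨a, ha⟩ : ∃ a, ∀ t ∈ Icc a (a + r / 2), t ∈ closedBall x r ∧ 2⁻¹ * (|x| + r) ≤ |t| := by
    rcases le_total 0 x with hx | hx
    · refine ⟨x + r / 2, fun t ht => ?_⟩
      rw [mem_closedBall, Real.dist_eq, abs_le, abs_of_nonneg hx, le_abs]
      have := ht.1; have := ht.2
      exact ⟨⟨by linarith, by linarith⟩, Or.inl (by linarith)⟩
    · refine ⟨x - r, fun t ht => ?_⟩
      rw [mem_closedBall, Real.dist_eq, abs_le, abs_of_nonpos hx, le_abs]
      have := ht.1; have := ht.2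
      exact ⟨⟨by linarith, by linarith⟩, Or.inr (by linarith)⟩
  rw [muK1_apply _ measurableSet_closedBall]
  calc ENNReal.ofReal (2⁻¹ ^ (1 + 2 * κ) * (r * (|x| + r) ^ (2 * κ)))
      = ∫⁻ t in Icc a (a + r / 2), ENNReal.ofReal ((2⁻¹ * (|x| + r)) ^ (2 * κ)) := by
        rw [setLIntegral_const, Real.volume_Icc, ← ENNReal.ofReal_mul (by positivity),
          Real.mul_rpow (by norm_num) (by positivity), Real.rpow_add (by norm_num), Real.rpow_one]
        congr 1; ring
    _ ≤ ∫⁻ t in Icc a (a + r / 2), ENNReal.ofReal (|t| ^ (2 * κ)) := by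
        refine setLIntegral_mono' measurableSet_Icc fun t ht => ?_
        gcongr
        exact (ha t ht).2
    _ ≤ _ := lintegral_mono_set fun t ht => (ha t ht).1

theorem muK_closedBall (d : ℕ) (κ : Fin d → ℝ) (x : Fin d → ℝ) {r : ℝ} (hr : 0 ≤ r) :
    muK d κ (closedBall x r) = ∏ j, muK1 (κ j) (closedBall (x j) r) := by
  rw [closedBall_pi _ hr, muK_pi _ _ fun j => measurableSet_closedBall]

theorem isGlobDoubling_muK {d : ℕ} (hd : 1 ≤ d) {κ : Fin d → ℝ} (hκ : ∀ j, 0 < κ j) :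
    ∃ D : ℝ≥0, IsGlobDoubling (muK d κ) D := by
  refine ⟨∏ j, ((2 : ℝ) * 2 * 2 ^ (2 * κ j) * 2 ^ (1 + 2 * κ j)).toNNReal, ?_, ?_, ?_, ?_⟩
  · intro x r hr
    rw [muK_closedBall _ _ _ hr.le, muK_closedBall _ _ _ (by positivity), ENNReal.ofNNReal_finsetProd,
      ← Finset.prod_mul_distrib]
    refine Finset.prod_le_prod' fun j _ => ?_
    refine (muK1_closedBall_le (hκ j) _ _ (by positivity)).trans ?_
    calc ENNReal.ofReal (2 * (2 * r * (|x j| + 2 * r) ^ (2 * κ j)))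
        ≤ ENNReal.ofReal ((2 * 2 * 2 ^ (2 * κ j) * 2 ^ (1 + 2 * κ j)) *
          (2⁻¹ ^ (1 + 2 * κ j) * (r * (|x j| + r) ^ (2 * κ j)))) := by
          apply ENNReal.ofReal_le_ofReal
          have h1 : (|x j| + 2 * r) ^ (2 * κ j) ≤ 2 ^ (2 * κ j) * (|x j| + r) ^ (2 * κ j) := by
            rw [← Real.mul_rpow (by norm_num) (by positivity)]
            have := hκ j
            gcongr
            linarith [abs_nonneg (x j)]
          have h2 : (2:ℝ) ^ (1 + 2 * κ j) * 2⁻¹ ^ (1 + 2 * κ j) = 1 := by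
            rw [← Real.mul_rpow (by norm_num) (by norm_num)]; norm_num
          calc 2 * (2 * r * (|x j| + 2 * r) ^ (2 * κ j))
              ≤ 2 * (2 * r * (2 ^ (2 * κ j) * (|x j| + r) ^ (2 * κ j))) := by gcongr
            _ = 2 * 2 * 2 ^ (2 * κ j) * (2 ^ (1 + 2 * κ j) * 2⁻¹ ^ (1 + 2 * κ j)) *
                (r * (|x j| + r) ^ (2 * κ j)) := by rw [h2]; ring
            _ = _ := by ring
      _ ≤ _ := by
          rw [ENNReal.ofReal_mul (by positivity)]
          exact mul_le_mul_right (le_muK1_closedBall (hκ j) _ _ hr) _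
  · intro x r hr
    rw [muK_closedBall _ _ _ hr.le, Finset.prod_ne_zero_iff]
    intro j _
    refine (lt_of_lt_of_le ?_ (le_muK1_closedBall (hκ j) _ _ hr)).ne'
    rw [ENNReal.ofReal_pos]
    positivity
  · intro x r
    refine ne_top_of_le_ne_top ?_ (measure_mono (closedBall_subset_closedBall (le_max_left r 1)))
    rw [muK_closedBall _ _ _ (by positivity)]
    exact ENNReal.prod_ne_top fun j _ => ne_top_of_le_ne_top ENNReal.ofReal_ne_top
      (muK1_closedBall_le (hκ j) _ _ (by positivity))
  · intro K hK
    set c : Fin d → ℝ := fun j => 2⁻¹ ^ (1 + 2 * κ j) with hc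
    have hc0 : 0 < ∏ j, c j := Finset.prod_pos fun j _ => by simp only [hc]; positivity
    refine ⟨max 1 (K.toReal / ∏ j, c j), fun x r hr h => ?_⟩
    by_contra! hcon
    have hr1 : 1 < r := (le_max_left _ _).trans_lt hcon
    have hlow : ENNReal.ofReal ((∏ j, c j) * r) ≤ muK d κ (closedBall x r) := by
      rw [muK_closedBall _ _ _ hr.le]
      calc ENNReal.ofReal ((∏ j, c j) * r) ≤ ENNReal.ofReal (∏ j, (c j * r)) := by
            apply ENNReal.ofReal_le_ofReal
            rw [Finset.prod_mul_distrib]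
            gcongr
            simpa using le_self_pow₀ hr1.le (by omega : d ≠ 0)
        _ = ∏ j, ENNReal.ofReal (c j * r) := ENNReal.ofReal_prod_of_nonneg fun j _ => by
            simp only [hc]; positivity
        _ ≤ _ := by
            refine Finset.prod_le_prod' fun j _ =>
              le_trans ?_ (le_muK1_closedBall (hκ j) (x j) r hr)
            apply ENNReal.ofReal_le_ofReal
            have : 1 ≤ (|x j| + r) ^ (2 * κ j) :=
              Real.one_le_rpow (by linarith [abs_nonneg (x j)]) (by linarith [hκ j])
            simp only [hc]
            gcongr
            nlinarith
    have h1 := ENNReal.toReal_mono hK (hlow.trans h)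
    rw [ENNReal.toReal_ofReal (by positivity)] at h1
    have h2 := (le_max_right _ _).trans_lt hcon
    rw [div_lt_iff₀ hc0] at h2
    linarith

theorem lintegral_rpow_Ioo {p : ℝ} (hp : 0 < p) {s : ℝ} (hs : 0 ≤ s) :
    ∫⁻ t in Ioo 0 s, ENNReal.ofReal (t ^ (p - 1)) = ENNReal.ofReal (p⁻¹ * s ^ p) := by
  have h := lintegral_rpow_sub_one_lt hp (ENNReal.ofReal s)
  have he : {t : ℝ | ENNReal.ofReal t < ENNReal.ofReal s} ∩ Ioi 0 = Ioo 0 s := by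
    ext t
    simp only [mem_inter_iff, mem_ofPred_eq, mem_Ioi, mem_Ioo]
    constructor
    · rintro ⟨h1, h2⟩
      exact ⟨h2, (ENNReal.ofReal_lt_ofReal_iff_of_nonneg h2.le).1 h1⟩
    · rintro ⟨h1, h2⟩
      exact ⟨(ENNReal.ofReal_lt_ofReal_iff_of_nonneg h1.le).2 h2, h1⟩
  rw [lintegral_indicator (measurableSet_lt (by fun_prop) (by fun_prop)),
    Measure.restrict_restrict (measurableSet_lt (by fun_prop) (by fun_prop)), he] at h
  rw [h, ENNReal.ofReal_rpow_of_nonneg hs hp.le, ENNReal.ofReal_mul (by positivity)]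

theorem lintegral_sub_rpow_Ioo {p : ℝ} (hp : 0 < p) {L : ℝ} (hL : 0 ≤ L) :
    ∫⁻ t in Ioo 0 L, ENNReal.ofReal ((L - t) ^ (p - 1)) = ENNReal.ofReal (p⁻¹ * L ^ p) := by
  rw [← lintegral_rpow_Ioo hp hL, ← lintegral_indicator measurableSet_Ioo,
    ← lintegral_indicator measurableSet_Ioo, ← lintegral_sub_left_eq_self _ L]
  refine lintegral_congr fun t => ?_
  by_cases ht : t ∈ Ioo 0 L
  · have ht' : L - t ∈ Ioo 0 L := ⟨by linarith [ht.2], by linarith [ht.1]⟩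
    rw [indicator_of_mem ht', indicator_of_mem ht]; simp
  · have ht' : L - t ∉ Ioo 0 L := fun h => ht ⟨by linarith [h.2], by linarith [h.1]⟩
    rw [indicator_of_notMem ht', indicator_of_notMem ht]

theorem rpow_le_of_half_le (p : ℝ) {L w : ℝ} (hL : 0 < L) (h1 : L / 2 ≤ w) (h2 : w ≤ L) :
    w ^ p ≤ max 1 (2 ^ (-p)) * L ^ p := by
  rcases le_total 0 p with hp | hp
  · calc w ^ p ≤ 1 * L ^ p := by
          rw [one_mul]
          have : 0 ≤ w := by linarith
          gcongr
      _ ≤ _ := by gcongr; exact le_max_left _ _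
  · calc w ^ p ≤ (L / 2) ^ p := Real.rpow_le_rpow_of_nonpos (by linarith) h1 hp
      _ = 2 ^ (-p) * L ^ p := by
          rw [Real.div_rpow hL.le (by norm_num), Real.rpow_neg (by norm_num)]; ring
      _ ≤ _ := by gcongr; exact le_max_right _ _

/-- Incomplete beta integral bound. -/
theorem exists_lintegral_beta_le {κ : ℝ} (hκ : 0 < κ) :
    ∃ C : ℝ, 0 < C ∧ ∀ L s : ℝ, 0 < s → s ≤ L →
      ∫⁻ v in Ioo 0 s, ENNReal.ofReal ((v * (L - v)) ^ (κ - 1)) ≤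
        ENNReal.ofReal (C * (L ^ (κ - 1) * s ^ κ)) := by
  set K : ℝ := max 1 (2 ^ (-(κ - 1))) with hK
  have hK0 : 0 < K := lt_max_of_lt_left one_pos
  refine ⟨K * κ⁻¹ + K * κ⁻¹ * 2 ^ κ, by positivity, fun L s hs hsL => ?_⟩
  have hL : 0 < L := hs.trans_le hsL
  set A : ℝ≥0∞ := ENNReal.ofReal (K * L ^ (κ - 1)) with hA
  have hpt : ∀ v ∈ Ioo 0 s, ENNReal.ofReal ((v * (L - v)) ^ (κ - 1)) ≤
      A * ENNReal.ofReal (v ^ (κ - 1)) +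
        (Ioi (L / 2)).indicator (fun v => A * ENNReal.ofReal ((L - v) ^ (κ - 1))) v := by
    intro v hv
    have hv0 : 0 < v := hv.1
    have hvL : v < L := hv.2.trans_le hsL
    rw [Real.mul_rpow hv0.le (by linarith)]
    have hA' : ∀ w : ℝ, A * ENNReal.ofReal w = ENNReal.ofReal (K * L ^ (κ - 1) * w) := fun w => by
      rw [hA, ← ENNReal.ofReal_mul (by positivity)]
    by_cases h : L / 2 < v
    · refine le_add_left ?_
      rw [indicator_of_mem (show v ∈ Ioi (L / 2) from h), hA']
      apply ENNReal.ofReal_le_ofReal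
      have : 0 ≤ (L - v) ^ (κ - 1) := Real.rpow_nonneg (by linarith) _
      gcongr
      exact rpow_le_of_half_le _ hL h.le hvL.le
    · refine le_add_right ?_
      rw [hA', mul_comm (v ^ _)]
      apply ENNReal.ofReal_le_ofReal
      gcongr
      exact rpow_le_of_half_le _ hL (by linarith) (by linarith)
  have h2 : ∫⁻ v in Ioo 0 s,
      (Ioi (L / 2)).indicator (fun v => A * ENNReal.ofReal ((L - v) ^ (κ - 1))) v ≤
      A * ENNReal.ofReal (κ⁻¹ * 2 ^ κ * s ^ κ) := by
    rw [lintegral_indicator measurableSet_Ioi, Measure.restrict_restrict measurableSet_Ioi]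
    rcases le_or_gt s (L / 2) with h | h
    · have : Ioi (L / 2) ∩ Ioo 0 s = ∅ := by
        ext v; simp only [mem_inter_iff, mem_Ioi, mem_Ioo, mem_empty_iff_false, iff_false]
        rintro ⟨h1, h2, h3⟩; linarith
      simp [this]
    · rw [lintegral_const_mul _ (by fun_prop)]
      gcongr
      calc ∫⁻ v in Ioi (L / 2) ∩ Ioo 0 s, ENNReal.ofReal ((L - v) ^ (κ - 1))
          ≤ ∫⁻ v in Ioo 0 L, ENNReal.ofReal ((L - v) ^ (κ - 1)) :=
            lintegral_mono_set fun v hv => ⟨hv.2.1, hv.2.2.trans_le hsL⟩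
        _ = ENNReal.ofReal (κ⁻¹ * L ^ κ) := lintegral_sub_rpow_Ioo hκ hL.le
        _ ≤ _ := by
            apply ENNReal.ofReal_le_ofReal
            rw [mul_assoc, ← Real.mul_rpow (by norm_num) hs.le]
            gcongr
            linarith
  calc ∫⁻ v in Ioo 0 s, ENNReal.ofReal ((v * (L - v)) ^ (κ - 1))
      ≤ ∫⁻ v in Ioo 0 s, (A * ENNReal.ofReal (v ^ (κ - 1)) +
        (Ioi (L / 2)).indicator (fun v => A * ENNReal.ofReal ((L - v) ^ (κ - 1))) v) :=
        setLIntegral_mono' measurableSet_Ioo hpt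
    _ ≤ A * ENNReal.ofReal (κ⁻¹ * s ^ κ) + A * ENNReal.ofReal (κ⁻¹ * 2 ^ κ * s ^ κ) := by
        rw [lintegral_add_left (by fun_prop), lintegral_const_mul _ (by fun_prop),
          lintegral_rpow_Ioo hκ hs.le]
        gcongr
    _ = _ := by
        rw [← mul_add, ← ENNReal.ofReal_add (by positivity) (by positivity), hA,
          ← ENNReal.ofReal_mul (by positivity)]
        congr 1; ring

theorem Mconst_pos {κ : ℝ} (hκ : 0 < κ) : 0 < Mconst κ := by
  have h1 := Real.Gamma_pos_of_pos hκ
  have h2 := Real.Gamma_pos_of_pos (show (0:ℝ) < κ + 1 / 2 by linarith)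
  have h3 := Real.Gamma_pos_of_pos (show (0:ℝ) < 1 / 2 by norm_num)
  exact div_pos h2 (mul_pos h1 h3)

theorem triArea_rpow {κ x y z : ℝ} (h : 0 ≤ (z ^ 2 - (x - y) ^ 2) * ((x + y) ^ 2 - z ^ 2)) :
    triArea x y z ^ (2 * κ - 2) =
      16⁻¹ ^ (κ - 1) * ((z ^ 2 - (x - y) ^ 2) * ((x + y) ^ 2 - z ^ 2)) ^ (κ - 1) := by
  rw [triArea, ← Real.mul_rpow (by norm_num) h, Real.sqrt_eq_rpow,
    show (x + y + z) / 2 * ((x + y + z) / 2 - x) * ((x + y + z) / 2 - y) * ((x + y + z) / 2 - z) =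
      16⁻¹ * ((z ^ 2 - (x - y) ^ 2) * ((x + y) ^ 2 - z ^ 2)) by ring,
    ← Real.rpow_mul (by positivity)]
  congr 1; ring

theorem nuDens_le {κ : ℝ} (hκ : 0 < κ) {x y : ℝ} (hx : x ≠ 0) (hy : y ≠ 0) (z : ℝ) :
    nuDens κ x y z ≤ (Icc ((|x| - |y|) ^ 2) ((|x| + |y|) ^ 2)).indicator (fun u =>
      ENNReal.ofReal (2 ^ (2 * κ - 2) * Mconst κ * 16⁻¹ ^ (κ - 1) * (|x| * |y|) ^ (1 - 2 * κ) *
        ((u - (|x| - |y|) ^ 2) * ((|x| + |y|) ^ 2 - u)) ^ (κ - 1))) (z ^ 2) *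
        ENNReal.ofReal |z| := by
  have ha : 0 < |x| := abs_pos.2 hx
  have hb : 0 < |y| := abs_pos.2 hy
  have hM := Mconst_pos hκ
  rcases eq_or_ne z 0 with rfl | hz
  · simp [nuDens, Real.zero_rpow (show 2 * κ ≠ 0 by positivity)]
  have hw : 0 < |z| := abs_pos.2 hz
  by_cases h : |(|x| - |y|)| ≤ |z| ∧ |z| ≤ |x| + |y|
  · have h1 : (|x| - |y|) ^ 2 ≤ z ^ 2 := sq_le_sq.2 h.1
    have h2 : z ^ 2 ≤ (|x| + |y|) ^ 2 := by
      rw [← sq_abs z]; exact pow_le_pow_left₀ hw.le h.2 2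
    rw [indicator_of_mem (show z ^ 2 ∈ Icc _ _ from ⟨h1, h2⟩), nuDens, Kker, if_pos h,
      triArea_rpow (by
        rw [sq_abs]; exact mul_nonneg (by linarith) (by linarith)),
      sq_abs, ← ENNReal.ofReal_mul' hw.le]
    apply ENNReal.ofReal_le_ofReal
    set A : ℝ := ((z ^ 2 - (|x| - |y|) ^ 2) * ((|x| + |y|) ^ 2 - z ^ 2)) with hA
    have hA0 : 0 ≤ A := mul_nonneg (by linarith) (by linarith)
    have hσ : 1 - sigma3 x y z ≤ 2 := by
      rw [sigma3, if_pos ⟨hx, hy⟩]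
      have : -1 ≤ (x ^ 2 + y ^ 2 - z ^ 2) / (2 * x * y) := by
        refine (abs_le.1 ?_).1
        rw [abs_div, div_le_one (by positivity), abs_mul, abs_mul, abs_two, abs_le]
        constructor <;> nlinarith [sq_abs x, sq_abs y]
      linarith
    have hwz : |z| ^ (1 - 2 * κ) * |z| ^ (2 * κ) = |z| := by
      rw [← Real.rpow_add hw]; simp
    rw [Real.mul_rpow (by positivity) hw.le]
    have h0 : 0 ≤ 1 / 2 * (2 ^ (2 * κ - 2) * Mconst κ * (16⁻¹ ^ (κ - 1) * A ^ (κ - 1)) *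
        ((|x| * |y|) ^ (1 - 2 * κ) * |z| ^ (1 - 2 * κ))) := by positivity
    calc _ ≤ 1 / 2 * (2 ^ (2 * κ - 2) * Mconst κ * (16⁻¹ ^ (κ - 1) * A ^ (κ - 1)) *
        ((|x| * |y|) ^ (1 - 2 * κ) * |z| ^ (1 - 2 * κ))) * 2 * |z| ^ (2 * κ) := by gcongr
      _ = 2 ^ (2 * κ - 2) * Mconst κ * (16⁻¹ ^ (κ - 1) * A ^ (κ - 1)) *
        ((|x| * |y|) ^ (1 - 2 * κ)) * (|z| ^ (1 - 2 * κ) * |z| ^ (2 * κ)) := by ring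
      _ = _ := by rw [hwz]; ring
  · simp [nuDens, Kker, if_neg h]

theorem setLIntegral_sq_mul_abs_le (G : ℝ → ℝ≥0∞) {r : ℝ} (hr : 0 < r) :
    ∫⁻ z in Ioo (-r) r, G (z ^ 2) * ENNReal.ofReal |z| ≤ 2 * ∫⁻ u in Ioo 0 (r ^ 2), G u := by
  have key : ∀ s : Set ℝ, MeasurableSet s → InjOn (fun z : ℝ => z ^ 2) s →
      (∀ z ∈ s, z ^ 2 ∈ Ioo 0 (r ^ 2)) →
      ∫⁻ z in s, G (z ^ 2) * ENNReal.ofReal |z| ≤ ∫⁻ u in Ioo 0 (r ^ 2), G u := by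
    intro s hs hinj hsub
    have h := lintegral_image_eq_lintegral_abs_deriv_mul hs (f := fun z => z ^ 2)
      (f' := fun z => 2 * z) (fun z _ => by simpa using (hasDerivAt_pow 2 z).hasDerivWithinAt)
      hinj G
    calc ∫⁻ z in s, G (z ^ 2) * ENNReal.ofReal |z|
        ≤ ∫⁻ z in s, ENNReal.ofReal |2 * z| * G (z ^ 2) := by
          refine lintegral_mono fun z => ?_
          rw [mul_comm]
          gcongr ENNReal.ofReal ?_ * _
          rw [abs_mul, abs_two]
          linarith [abs_nonneg z]
      _ = ∫⁻ u in (fun z : ℝ => z ^ 2) '' s, G u := h.symm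
      _ ≤ _ := lintegral_mono_set (by rintro _ ⟨z, hz, rfl⟩; exact hsub z hz)
  have hsplit : Ioo (-r) r ⊆ (Ioo (-r) 0 ∪ Ioo 0 r) ∪ {0} := by
    intro z hz
    rcases lt_trichotomy z 0 with h | h | h
    · exact Or.inl (Or.inl ⟨hz.1, h⟩)
    · exact Or.inr h
    · exact Or.inl (Or.inr ⟨h, hz.2⟩)
  calc ∫⁻ z in Ioo (-r) r, G (z ^ 2) * ENNReal.ofReal |z|
      ≤ ∫⁻ z in (Ioo (-r) 0 ∪ Ioo 0 r) ∪ {0}, G (z ^ 2) * ENNReal.ofReal |z| :=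
        lintegral_mono_set hsplit
    _ ≤ ((∫⁻ z in Ioo (-r) 0, G (z ^ 2) * ENNReal.ofReal |z|) +
          ∫⁻ z in Ioo 0 r, G (z ^ 2) * ENNReal.ofReal |z|) +
          ∫⁻ z in ({0} : Set ℝ), G (z ^ 2) * ENNReal.ofReal |z| :=
        (lintegral_union_le _ _ _).trans (by gcongr; exact lintegral_union_le _ _ _)
    _ ≤ (∫⁻ u in Ioo 0 (r ^ 2), G u) + ∫⁻ u in Ioo 0 (r ^ 2), G u := by
        rw [Measure.restrict_singleton]
        simp only [Real.volume_singleton, zero_smul, lintegral_zero_measure, add_zero]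
        refine add_le_add ?_ ?_
        · refine key _ measurableSet_Ioo (fun a ha b hb hab => ?_) fun z hz => ?_
          · have h1 := ha.2; have h2 := hb.2
            simp only at hab
            nlinarith [sq_eq_sq_iff_abs_eq_abs a b |>.1 hab, abs_of_neg h1, abs_of_neg h2]
          · have h1 := hz.1; have h2 := hz.2
            exact ⟨by nlinarith, by nlinarith⟩
        · refine key _ measurableSet_Ioo (fun a ha b hb hab => ?_) fun z hz => ?_
          · have h1 := ha.1; have h2 := hb.1
            simp only at hab
            nlinarith [sq_eq_sq_iff_abs_eq_abs a b |>.1 hab, abs_of_pos h1, abs_of_pos h2]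
          · have h1 := hz.1; have h2 := hz.2
            exact ⟨by positivity, by nlinarith⟩
    _ = _ := by rw [two_mul]

theorem setLIntegral_nuDens_eq_zero {κ : ℝ} (hκ : 0 < κ) {x y : ℝ} (hx : x ≠ 0) (hy : y ≠ 0)
    {r : ℝ} (hr : r ≤ |(|x| - |y|)|) : ∫⁻ z in Ioo (-r) r, nuDens κ x y z = 0 := by
  refine (setLIntegral_congr_fun measurableSet_Ioo fun z hz => ?_).trans lintegral_zero
  refine le_antisymm ((nuDens_le hκ hx hy z).trans ?_) zero_le
  rw [indicator_of_notMem, zero_mul]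
  intro h
  have h1 := sq_le_sq.1 h.1
  have := abs_lt.2 ⟨hz.1, hz.2⟩
  linarith

theorem exists_setLIntegral_nuDens_le {κ : ℝ} (hκ : 0 < κ) :
    ∃ C : ℝ, 0 < C ∧ ∀ x y r : ℝ, x ≠ 0 → y ≠ 0 → |(|x| - |y|)| < r →
      ∫⁻ z in Ioo (-r) r, nuDens κ x y z ≤ ENNReal.ofReal (C * (r / (|x| + r)) ^ (2 * κ)) := by
  obtain ⟨C, hC, hbeta⟩ := exists_lintegral_beta_le hκ
  set c : ℝ := 2 ^ (2 * κ - 2) * Mconst κ * 16⁻¹ ^ (κ - 1) with hc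
  have hc0 : 0 < c := by have := Mconst_pos hκ; positivity
  refine ⟨2 * (c * C * 4 ^ (κ - 1)) * 36 ^ κ, by positivity, fun x y r hx hy hr => ?_⟩
  have ha : 0 < |x| := abs_pos.2 hx
  have hb : 0 < |y| := abs_pos.2 hy
  set a := |x|
  set b := |y|
  have hr0 : 0 < r := (abs_nonneg _).trans_lt hr
  have hP : (a - b) ^ 2 < r ^ 2 := by
    rw [← sq_abs (a - b)]; exact pow_lt_pow_left₀ hr (abs_nonneg _) two_ne_zero
  set G : ℝ → ℝ≥0∞ := (Icc ((a - b) ^ 2) ((a + b) ^ 2)).indicator (fun u =>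
      ENNReal.ofReal (c * (a * b) ^ (1 - 2 * κ) *
        ((u - (a - b) ^ 2) * ((a + b) ^ 2 - u)) ^ (κ - 1))) with hG
  set s : ℝ := min (4 * (a * b)) (r ^ 2) with hs
  have hs0 : 0 < s := lt_min (by positivity) (by positivity)
  have hGs : ∫⁻ u in Ioo 0 (r ^ 2), G u ≤
      ENNReal.ofReal (c * C * 4 ^ (κ - 1) * (s / (a * b)) ^ κ) := by
    calc ∫⁻ u in Ioo 0 (r ^ 2), G u
        = ∫⁻ u, (Ioo 0 (r ^ 2)).indicator G u := (lintegral_indicator measurableSet_Ioo _).symm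
      _ = ∫⁻ v, (Ioo 0 (r ^ 2)).indicator G (v + (a - b) ^ 2) :=
          (lintegral_add_right_eq_self _ _).symm
      _ ≤ ∫⁻ v, (Icc 0 s).indicator (fun v => ENNReal.ofReal (c * (a * b) ^ (1 - 2 * κ)) *
            ENNReal.ofReal ((v * (4 * (a * b) - v)) ^ (κ - 1))) v := by
          refine lintegral_mono fun v => ?_
          simp only [hG, indicator_apply]
          split_ifs with h1 h2 h3 h3
          · rw [← ENNReal.ofReal_mul (by positivity)]
            apply le_of_eq
            congr 3; ring
          · exact absurd ⟨by linarith [h2.1], le_min (by linarith [h2.2]) (by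
              linarith [h1.2, sq_nonneg (a - b)])⟩ h3
          all_goals exact zero_le
      _ = ∫⁻ v in Ioo 0 s, ENNReal.ofReal (c * (a * b) ^ (1 - 2 * κ)) *
            ENNReal.ofReal ((v * (4 * (a * b) - v)) ^ (κ - 1)) := by
          rw [lintegral_indicator measurableSet_Icc, setLIntegral_congr Ioo_ae_eq_Icc]
      _ ≤ ENNReal.ofReal (c * (a * b) ^ (1 - 2 * κ)) *
            ENNReal.ofReal (C * ((4 * (a * b)) ^ (κ - 1) * s ^ κ)) := by
          rw [lintegral_const_mul _ (by fun_prop)]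
          gcongr
          exact hbeta _ _ hs0 (min_le_left _ _)
      _ = _ := by
          rw [← ENNReal.ofReal_mul (by positivity), Real.div_rpow hs0.le (by positivity),
            Real.mul_rpow (x := 4) (y := a * b) (by norm_num) (by positivity)]
          congr 1
          have h1 : (a * b) ^ (1 - 2 * κ) * (a * b) ^ (κ - 1) = ((a * b) ^ κ)⁻¹ := by
            rw [← Real.rpow_add (by positivity), ← Real.rpow_neg (by positivity)]
            congr 1; ring
          rw [div_eq_mul_inv, ← h1]; ring
  have hsab : s / (a * b) ≤ 36 * (r / (a + r)) ^ 2 := by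
    rw [div_pow, div_le_iff₀ (by positivity), mul_div_assoc', div_mul_eq_mul_div,
      le_div_iff₀ (by positivity)]
    rcases le_total a (2 * r) with h | h
    · calc s * (a + r) ^ 2 ≤ 4 * (a * b) * (3 * r) ^ 2 := by
            gcongr
            · exact min_le_left _ _
            · linarith
        _ = _ := by ring
    · have hb' : a / 2 ≤ b := by linarith [(abs_lt.1 hr).2]
      calc s * (a + r) ^ 2 ≤ r ^ 2 * (3 / 2 * a) ^ 2 := by
            gcongr
            · exact min_le_right _ _
            · linarith
        _ ≤ 36 * r ^ 2 * (a * (a / 2)) := by nlinarith [mul_pos hr0 ha]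
        _ ≤ _ := by gcongr
  calc ∫⁻ z in Ioo (-r) r, nuDens κ x y z
      ≤ ∫⁻ z in Ioo (-r) r, G (z ^ 2) * ENNReal.ofReal |z| :=
        lintegral_mono fun z => nuDens_le hκ hx hy z
    _ ≤ 2 * ∫⁻ u in Ioo 0 (r ^ 2), G u := setLIntegral_sq_mul_abs_le _ hr0
    _ ≤ 2 * ENNReal.ofReal (c * C * 4 ^ (κ - 1) * (s / (a * b)) ^ κ) := by gcongr
    _ = ENNReal.ofReal (2 * (c * C * 4 ^ (κ - 1)) * (s / (a * b)) ^ κ) := by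
        rw [mul_assoc 2, ENNReal.ofReal_mul zero_le_two, ENNReal.ofReal_ofNat]
    _ ≤ ENNReal.ofReal (2 * (c * C * 4 ^ (κ - 1)) * (36 * (r / (a + r)) ^ 2) ^ κ) := by gcongr
    _ = _ := by
        rw [Real.mul_rpow (by norm_num) (by positivity), ← Real.rpow_natCast_mul (by positivity)]
        push_cast
        congr 1; ring

theorem measurable_nuDens (κ x y : ℝ) : Measurable (nuDens κ x y) := by
  have h1 : Measurable fun z => Kker κ |x| |y| |z| := by
    refine Measurable.ite ?_ ?_ measurable_const
    · exact (measurableSet_le (f := fun _ : ℝ => |(|x| - |y|)|) (g := fun z : ℝ => |z|)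
        (by fun_prop) (by fun_prop)).inter
        (measurableSet_le (f := fun z : ℝ => |z|) (g := fun _ : ℝ => |x| + |y|)
          (by fun_prop) (by fun_prop))
    · unfold triArea
      fun_prop
  have h2 : Measurable fun z => sigma3 x y z := by
    unfold sigma3
    split_ifs <;> fun_prop
  unfold nuDens
  fun_prop

theorem eBall_subset_pi_Ioo (d : ℕ) {r : ℝ} (hr : 0 < r) :
    eBall d r ⊆ univ.pi fun _ => Ioo (-r) r := by
  intro x hx j _
  have hx' : ∑ j, (x j) ^ 2 < r ^ 2 := hx
  have h1 : (x j) ^ 2 < r ^ 2 :=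
    (Finset.single_le_sum (f := fun j => (x j) ^ 2) (fun i _ => sq_nonneg _)
      (Finset.mem_univ j)).trans_lt hx'
  exact abs_lt.1 (abs_lt_of_sq_lt_sq h1 hr.le)

theorem closedBall_subset_eBall (d : ℕ) {r : ℝ} (hr : 0 < r) :
    closedBall (0 : Fin d → ℝ) (r / (d + 1)) ⊆ eBall d r := by
  intro x hx
  have hx' : ∀ j, |x j| ≤ r / (d + 1) := by
    have : ‖x‖ ≤ r / (d + 1) := by simpa using hx
    exact fun j => (norm_le_pi_norm x j).trans this
  change ∑ j, (x j) ^ 2 < r ^ 2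
  calc ∑ j, (x j) ^ 2 ≤ ∑ _j : Fin d, (r / (d + 1)) ^ 2 := by
        refine Finset.sum_le_sum fun j _ => ?_
        rw [← sq_abs (x j)]
        gcongr
        exact hx' j
    _ = d * (r / (d + 1)) ^ 2 := by simp
    _ < r ^ 2 := by
        rw [div_pow, mul_div_assoc', div_lt_iff₀ (by positivity)]
        have : (0 : ℝ) ≤ d := Nat.cast_nonneg d
        nlinarith [mul_pos hr hr, mul_nonneg this (mul_pos hr hr).le,
          mul_nonneg (mul_nonneg this this) (mul_pos hr hr).le]

theorem le_muK_eBall {d : ℕ} {κ : Fin d → ℝ} (hκ : ∀ j, 0 < κ j) {r : ℝ} (hr : 0 < r) :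
    ∏ j, (2⁻¹ ^ (1 + 2 * κ j) * ((d : ℝ) + 1)⁻¹ ^ (1 + 2 * κ j) * r ^ (1 + 2 * κ j)) ≤
      (muK d κ (eBall d r)).toReal := by
  have hfin : muK d κ (eBall d r) ≠ ∞ := by
    refine ne_top_of_le_ne_top ?_ (measure_mono (t := closedBall 0 r) fun x hx => ?_)
    · rw [muK_closedBall _ _ _ hr.le]
      exact ENNReal.prod_ne_top fun j _ => ne_top_of_le_ne_top ENNReal.ofReal_ne_top
        (muK1_closedBall_le (hκ j) _ _ hr)
    · rw [closedBall_pi _ hr.le]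
      intro j _
      have := eBall_subset_pi_Ioo d hr hx j (mem_univ j)
      rw [mem_closedBall, Real.dist_eq]
      simpa using (abs_lt.2 ⟨this.1, this.2⟩).le
  rw [← ENNReal.ofReal_le_iff_le_toReal hfin]
  refine le_trans ?_ (measure_mono (closedBall_subset_eBall d hr))
  rw [muK_closedBall _ _ _ (by positivity), ENNReal.ofReal_prod_of_nonneg fun j _ => by positivity]
  refine Finset.prod_le_prod' fun j _ =>
    le_trans (le_of_eq ?_) (le_muK1_closedBall (hκ j) _ _ (by positivity))
  congr 1
  rw [mul_assoc]
  congr 1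
  rw [← Real.mul_rpow (by positivity) hr.le, Real.rpow_add (by positivity), Real.rpow_one]
  simp [div_eq_inv_mul]

theorem upsilon_eBall_le {d : ℕ} {κ C : Fin d → ℝ} (hκ : ∀ j, 0 < κ j)
    (hC : ∀ j, ∀ x y r : ℝ, x ≠ 0 → y ≠ 0 → |(|x| - |y|)| < r →
      ∫⁻ z in Ioo (-r) r, nuDens (κ j) x y z ≤
        ENNReal.ofReal (C j * (r / (|x| + r)) ^ (2 * κ j)))
    {x y : Fin d → ℝ} (hx : x ∈ regSet d) (hy : y ∈ regSet d) {r : ℝ} (hr : 0 < r) :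
    upsilon d κ x y (eBall d r) ≤ {y | ∀ j, |(|x j| - |y j|)| < r}.indicator
      (fun _ => ∏ j, ENNReal.ofReal (C j * (r / (|x j| + r)) ^ (2 * κ j))) y := by
  have h1 : upsilon d κ x y (eBall d r) ≤
      ∏ j, ∫⁻ z in Ioo (-r) r, nuDens (κ j) (x j) (y j) z := by
    refine (measure_mono (eBall_subset_pi_Ioo d hr)).trans (le_of_eq ?_)
    rw [upsilon, withDensity_apply _ (MeasurableSet.univ_pi fun _ => measurableSet_Ioo)]
    exact setLIntegral_pi_prod (fun j => measurable_nuDens _ _ _) fun _ => measurableSet_Ioo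
  refine h1.trans ?_
  by_cases h : ∀ j, |(|x j| - |y j|)| < r
  · rw [indicator_of_mem (show y ∈ {y | ∀ j, |(|x j| - |y j|)| < r} from h)]
    exact Finset.prod_le_prod' fun j _ => hC j _ _ _ (hx j) (hy j) (h j)
  · push Not at h
    obtain ⟨j, hj⟩ := h
    rw [Finset.prod_eq_zero (Finset.mem_univ j)
      (setLIntegral_nuDens_eq_zero (hκ j) (hx j) (hy j) hj)]
    exact zero_le

/-- Change of sign of the coordinates selected by `ε`. -/
def signFlip {d : ℕ} (ε : Fin d → Bool) (x : Fin d → ℝ) : Fin d → ℝ :=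
  fun j => (if ε j then Neg.neg else id) (x j)

theorem abs_signFlip {d : ℕ} (ε : Fin d → Bool) (x : Fin d → ℝ) (j : Fin d) :
    |signFlip ε x j| = |x j| := by
  unfold signFlip
  split_ifs <;> simp

theorem volume_preserving_signFlip {d : ℕ} (ε : Fin d → Bool) :
    MeasurePreserving (signFlip ε) := by
  refine volume_preserving_pi fun j => ?_
  split_ifs
  · exact Measure.measurePreserving_neg volume
  · exact MeasurePreserving.id volume

theorem measurePreserving_signFlip {d : ℕ} (κ : Fin d → ℝ) (ε : Fin d → Bool) :
    MeasurePreserving (signFlip ε) (muK d κ) (muK d κ) := by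
  have hm := (volume_preserving_signFlip ε).measurable
  refine ⟨hm, ?_⟩
  ext s hs
  rw [Measure.map_apply hm hs, muK, withDensity_apply _ hs, withDensity_apply _ (hm hs),
    ← (volume_preserving_signFlip ε).setLIntegral_comp_preimage hs (by fun_prop)]
  simp only [abs_signFlip]

theorem subset_iUnion_closedBall_signFlip {d : ℕ} (x : Fin d → ℝ) {r : ℝ} (hr : 0 < r) :
    {y | ∀ j, |(|x j| - |y j|)| < r} ⊆ ⋃ ε : Fin d → Bool, closedBall (signFlip ε x) r := by
  intro y hy
  have hy' : ∀ j, |(|x j| - |y j|)| < r := hy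
  refine mem_iUnion.2 ⟨fun j => decide (x j * y j < 0), ?_⟩
  rw [closedBall_pi _ hr.le]
  intro j _
  rw [mem_closedBall, Real.dist_eq]
  refine le_trans (le_of_eq ?_) (hy' j).le
  rw [abs_sub_comm (|x j|)]
  by_cases h : x j * y j < 0
  · simp only [signFlip, h, decide_true, if_true]
    rcases mul_neg_iff.1 h with h' | h'
    · rw [abs_of_pos h'.1, abs_of_neg h'.2, ← abs_neg]; congr 1; ring
    · rw [abs_of_neg h'.1, abs_of_pos h'.2]
  · simp only [signFlip, h, decide_false, Bool.false_eq_true, if_false, id]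
    rcases mul_nonneg_iff.1 (not_lt.1 h) with h' | h'
    · rw [abs_of_nonneg h'.1, abs_of_nonneg h'.2]
    · rw [abs_of_nonpos h'.1, abs_of_nonpos h'.2, ← abs_neg]; congr 1; ring

theorem setLIntegral_le_maxFun_mul {E : Type*} [PseudoMetricSpace E] [MeasurableSpace E]
    {μ : Measure E} {D : ℝ≥0} (hμ : IsGlobDoubling μ D) (f : E → ℝ≥0∞) (x : E) {r : ℝ}
    (hr : 0 < r) :
    ∫⁻ y in closedBall x r, f y ∂μ ≤ maxFun μ f x * μ (closedBall x r) := by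
  calc ∫⁻ y in closedBall x r, f y ∂μ
      = (∫⁻ y in closedBall x r, f y ∂μ) / μ (closedBall x r) * μ (closedBall x r) := by
        rw [ENNReal.div_mul_cancel (hμ.pos _ _ hr) (hμ.finite _ _)]
    _ ≤ _ := by gcongr; exact average_le_maxFun f (mem_ball_self hr)

/-- The Dunkl maximal operator is dominated by the reflections of the maximal operator over
balls of the doubling measure `μ_κ`. -/
theorem exists_Mdunkl_le {d : ℕ} {κ : Fin d → ℝ} (hκ : ∀ j, 0 < κ j) {D : ℝ≥0}
    (hD : IsGlobDoubling (muK d κ) D) :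
    ∃ K : ℝ, 0 < K ∧ ∀ (f : (Fin d → ℝ) → ℝ) (x : Fin d → ℝ), Mdunkl d κ f x ≤
      ENNReal.ofReal K * ∑ ε : Fin d → Bool,
        maxFun (muK d κ) (fun y => ENNReal.ofReal |f y|) (signFlip ε x) := by
  choose C hC0 hC using fun j => exists_setLIntegral_nuDens_le (hκ j)
  set b : Fin d → ℝ := fun j => 2⁻¹ ^ (1 + 2 * κ j) * ((d : ℝ) + 1)⁻¹ ^ (1 + 2 * κ j) with hb
  have hb0 : ∀ j, 0 < b j := fun j => by simp only [hb]; positivity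
  refine ⟨|cKappa d κ| * ∏ j, (2 * C j / b j) + 1, ?_, fun f x => ?_⟩
  · have : 0 ≤ ∏ j, (2 * C j / b j) :=
      Finset.prod_nonneg fun j _ => by have := hC0 j; have := hb0 j; positivity
    positivity
  unfold Mdunkl
  split_ifs with hx
  swap
  · exact zero_le
  refine iSup_le fun r => iSup_le fun hr => ?_
  set A : ℝ≥0∞ := ∏ j, ENNReal.ofReal (C j * (r / (|x j| + r)) ^ (2 * κ j)) with hA
  set S : Set (Fin d → ℝ) := {y | ∀ j, |(|x j| - |y j|)| < r} with hS
  set V : ℝ≥0∞ := ∏ j, ENNReal.ofReal (2 * (r * (|x j| + r) ^ (2 * κ j))) with hV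
  set Mx : ℝ≥0∞ := ∑ ε : Fin d → Bool,
    maxFun (muK d κ) (fun y => ENNReal.ofReal |f y|) (signFlip ε x) with hMx
  have hSm : MeasurableSet S := by
    rw [hS, ofPred_forall]
    exact MeasurableSet.iInter fun j => measurableSet_lt (by fun_prop) measurable_const
  have hreg : MeasurableSet (regSet d) := by
    rw [regSet, ofPred_forall]
    exact MeasurableSet.iInter fun j =>
      (measurableSet_eq_fun (measurable_pi_apply j) measurable_const).compl
  have hint : ENNReal.ofReal |∫ y in regSet d, f y *
      (upsilon d κ x (-y) (eBall d r)).toReal ∂(muK d κ)| ≤ A * (V * Mx) := by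
    rw [← Real.enorm_eq_ofReal_abs]
    calc _ ≤ ∫⁻ y in regSet d, ‖f y * (upsilon d κ x (-y) (eBall d r)).toReal‖ₑ ∂(muK d κ) :=
          enorm_integral_le_lintegral_enorm _
      _ ≤ ∫⁻ y in regSet d, S.indicator (fun y => A * ENNReal.ofReal |f y|) y ∂(muK d κ) := by
          refine setLIntegral_mono' hreg fun y hy => ?_
          have hy' : -y ∈ regSet d := fun j => neg_ne_zero.2 (hy j)
          have h1 := upsilon_eBall_le hκ hC hx hy' hr
          rw [enorm_mul, Real.enorm_eq_ofReal_abs, Real.enorm_of_nonneg ENNReal.toReal_nonneg]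
          calc _ ≤ ENNReal.ofReal |f y| * S.indicator (fun _ => A) y := by
                gcongr
                refine ENNReal.ofReal_toReal_le.trans (h1.trans (le_of_eq ?_))
                simp [indicator_apply, hS, hA]
            _ = _ := by
                by_cases h : y ∈ S
                · simp [h, mul_comm]
                · simp [h]
      _ ≤ ∫⁻ y in S, A * ENNReal.ofReal |f y| ∂(muK d κ) := by
          rw [← lintegral_indicator hSm]
          exact setLIntegral_le_lintegral _ _
      _ = A * ∫⁻ y in S, ENNReal.ofReal |f y| ∂(muK d κ) :=
          lintegral_const_mul' _ _ (ENNReal.prod_ne_top fun j _ => ENNReal.ofReal_ne_top)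
      _ ≤ A * (V * Mx) := by
          gcongr
          calc ∫⁻ y in S, ENNReal.ofReal |f y| ∂(muK d κ)
              ≤ ∫⁻ y in ⋃ ε : Fin d → Bool, closedBall (signFlip ε x) r,
                  ENNReal.ofReal |f y| ∂(muK d κ) :=
                lintegral_mono_set (subset_iUnion_closedBall_signFlip x hr)
            _ ≤ ∑ ε : Fin d → Bool, ∫⁻ y in closedBall (signFlip ε x) r,
                  ENNReal.ofReal |f y| ∂(muK d κ) := by
                rw [← tsum_fintype (L := .unconditional _)]
                exact lintegral_iUnion_le _ _
            _ ≤ ∑ ε : Fin d → Bool, V *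
                  maxFun (muK d κ) (fun y => ENNReal.ofReal |f y|) (signFlip ε x) := by
                refine Finset.sum_le_sum fun ε _ =>
                  (setLIntegral_le_maxFun_mul hD _ _ hr).trans ?_
                rw [mul_comm, muK_closedBall _ _ _ hr.le, hV]
                gcongr with j
                rw [← abs_signFlip ε x j]
                exact muK1_closedBall_le (hκ j) _ _ hr
            _ = _ := (Finset.mul_sum _ _ _).symm
  have hm := le_muK_eBall hκ hr
  have hm0 : 0 < ∏ j, (b j * r ^ (1 + 2 * κ j)) :=
    Finset.prod_pos fun j _ => by have := hb0 j; positivity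
  rw [ENNReal.ofReal_mul' (abs_nonneg _)]
  calc _ ≤ ENNReal.ofReal (|cKappa d κ| / ∏ j, (b j * r ^ (1 + 2 * κ j))) * (A * (V * Mx)) := by
        gcongr
        exact le_abs_self _
    _ = ENNReal.ofReal (|cKappa d κ| / ∏ j, (b j * r ^ (1 + 2 * κ j))) * (A * V) * Mx := by ring
    _ ≤ _ := by
        gcongr
        rw [hA, hV, ← Finset.prod_mul_distrib]
        simp only [← ENNReal.ofReal_mul (mul_nonneg (hC0 _).le
          (Real.rpow_nonneg (div_nonneg hr.le (add_nonneg (abs_nonneg (x _)) hr.le)) _))]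
        rw [← ENNReal.ofReal_prod_of_nonneg fun j _ => by have := hC0 j; positivity,
          ← ENNReal.ofReal_mul (by positivity)]
        apply ENNReal.ofReal_le_ofReal
        refine le_trans (le_of_eq ?_) (le_add_of_nonneg_right zero_le_one)
        rw [div_mul_eq_mul_div, mul_div_assoc, ← Finset.prod_div_distrib]
        congr 1
        refine Finset.prod_congr rfl fun j _ => ?_
        have h0 : 0 < |x j| + r := by positivity
        have h1 : 0 < (|x j| + r) ^ (2 * κ j) := by positivity
        have h2 : 0 < r ^ (2 * κ j) := by positivity
        have h3 := hb0 j
        rw [Real.div_rpow hr.le h0.le, Real.rpow_add hr, Real.rpow_one]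
        field_simp

theorem Mdunkl_level_set_subset {d : ℕ} {κ : Fin d → ℝ} {K : ℝ}
    (hM : ∀ (f : (Fin d → ℝ) → ℝ) (x : Fin d → ℝ), Mdunkl d κ f x ≤
      ENNReal.ofReal K * ∑ ε : Fin d → Bool,
        maxFun (muK d κ) (fun y => ENNReal.ofReal |f y|) (signFlip ε x))
    {r : ℝ} (hr : 1 < r) (f : ℕ → (Fin d → ℝ) → ℝ) (a : ℝ≥0∞) :
    {x | ENNReal.ofReal K * 2 ^ d * a < (∑' n, Mdunkl d κ (f n) x ^ r) ^ (1 / r)} ⊆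
      ⋃ ε : Fin d → Bool, signFlip ε ⁻¹'
        {x | a ^ r < ∑' n, maxFun (muK d κ) (fun y => ENNReal.ofReal |f n y|) x ^ r} := by
  have hr0 : 0 < r := by linarith
  intro x hx
  have hx' : ENNReal.ofReal K * 2 ^ d * a < (∑' n, Mdunkl d κ (f n) x ^ r) ^ (1 / r) := hx
  rw [one_div, ENNReal.lt_rpow_inv_iff hr0] at hx'
  by_contra hcon
  have hcon' : ∀ ε : Fin d → Bool, ∑' n, maxFun (muK d κ) (fun y => ENNReal.ofReal |f n y|)
      (signFlip ε x) ^ r ≤ a ^ r := fun ε => not_lt.1 fun h => hcon (mem_iUnion.2 ⟨ε, h⟩)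
  refine absurd hx' (not_lt.2 ?_)
  have hN : ((2 : ℝ≥0∞) ^ d) ^ r = (2 ^ d) ^ (r - 1) * 2 ^ d := by
    conv_rhs => rw [← ENNReal.rpow_one (2 ^ d), ← ENNReal.rpow_mul, one_mul,
      ← ENNReal.rpow_add_of_nonneg _ _ (by linarith) zero_le_one, sub_add_cancel]
  calc ∑' n, Mdunkl d κ (f n) x ^ r
      ≤ ∑' n, ENNReal.ofReal K ^ r * ((2 ^ d) ^ (r - 1) * ∑ ε : Fin d → Bool,
          maxFun (muK d κ) (fun y => ENNReal.ofReal |f n y|) (signFlip ε x) ^ r) := by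
        refine ENNReal.tsum_le_tsum fun n => ?_
        refine (ENNReal.rpow_le_rpow (hM (f n) x) hr0.le).trans ?_
        rw [ENNReal.mul_rpow_of_nonneg _ _ hr0.le]
        gcongr
        refine (ENNReal.rpow_sum_le_const_mul_sum_rpow _ _ hr.le).trans (le_of_eq ?_)
        simp
    _ = ENNReal.ofReal K ^ r * ((2 ^ d) ^ (r - 1) * ∑ ε : Fin d → Bool,
          ∑' n, maxFun (muK d κ) (fun y => ENNReal.ofReal |f n y|) (signFlip ε x) ^ r) := by
        rw [ENNReal.tsum_mul_left, ENNReal.tsum_mul_left,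
          Summable.tsum_finsetSum fun _ _ => ENNReal.summable]
    _ ≤ ENNReal.ofReal K ^ r * ((2 ^ d) ^ (r - 1) * ∑ _ε : Fin d → Bool, a ^ r) := by
        gcongr with ε
        exact hcon' ε
    _ = _ := by
        rw [ENNReal.mul_rpow_of_nonneg _ _ hr0.le, ENNReal.mul_rpow_of_nonneg _ _ hr0.le, hN]
        simp
        ring

/-- Fefferman–Stein inequalities for the `ℤ_2^d` Dunkl maximal operator: weak type `(1,1)`. -/
theorem fefferman_stein_dunkl_weak
    (d : ℕ) (hd : 1 ≤ d) (κ : Fin d → ℝ) (hκ : ∀ j, 0 < κ j)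
    (r : ℝ) (hr : 1 < r) :
    ∃ C : ℝ, 0 < C ∧ ∀ f : ℕ → (Fin d → ℝ) → ℝ, (∀ n, Measurable (f n)) →
      (∫⁻ x, (∑' n, ENNReal.ofReal (|f n x|) ^ r) ^ (1/r) ∂(muK d κ)) < ∞ →
      ∀ lam : ℝ, 0 < lam →
      muK d κ {x | ENNReal.ofReal lam < (∑' n, Mdunkl d κ (f n) x ^ r) ^ (1/r)} ≤
        (ENNReal.ofReal C / ENNReal.ofReal lam) *
          ∫⁻ x, (∑' n, ENNReal.ofReal (|f n x|) ^ r) ^ (1/r) ∂(muK d κ) := by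
  obtain ⟨D, hD⟩ := isGlobDoubling_muK hd hκ
  obtain ⟨K, hK, hM⟩ := exists_Mdunkl_le hκ hD
  obtain ⟨C, hC⟩ := hD.vector_weak_type hr
  refine ⟨2 ^ d * (K * 2 ^ d * (C + 1)), by positivity, fun f hf hI lam hlam => ?_⟩
  set I := ∫⁻ x, (∑' n, ENNReal.ofReal (|f n x|) ^ r) ^ (1/r) ∂(muK d κ)
  set a : ℝ≥0∞ := ENNReal.ofReal (lam / (K * 2 ^ d)) with ha
  have ha0 : a ≠ 0 := by
    rw [ha, Ne, ENNReal.ofReal_eq_zero, not_le]; positivity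
  set T : Set (Fin d → ℝ) :=
    {x | a ^ r < ∑' n, maxFun (muK d κ) (fun y => ENNReal.ofReal |f n y|) x ^ r} with hT
  have hTm : MeasurableSet T := measurableSet_lt measurable_const
    (Measurable.tsum fun n => (measurable_maxFun _).pow_const r)
  have hlam' : ENNReal.ofReal lam = ENNReal.ofReal K * 2 ^ d * a := by
    rw [ha, show (2 : ℝ≥0∞) ^ d = ENNReal.ofReal (2 ^ d) by
      rw [ENNReal.ofReal_pow zero_le_two, ENNReal.ofReal_ofNat], ← ENNReal.ofReal_mul hK.le,
      ← ENNReal.ofReal_mul (by positivity)]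
    congr 1
    field_simp
  have hTa : a * muK d κ T ≤ C * I :=
    hC (fun n y => ENNReal.ofReal |f n y|) (fun n => (hf n).abs.ennreal_ofReal) hI.ne a ha0
      ENNReal.ofReal_ne_top
  have hS : muK d κ {x | ENNReal.ofReal lam < (∑' n, Mdunkl d κ (f n) x ^ r) ^ (1/r)} ≤
      2 ^ d * muK d κ T := by
    rw [hlam']
    calc _ ≤ ∑ ε : Fin d → Bool, muK d κ (signFlip ε ⁻¹' T) :=
          (measure_mono (Mdunkl_level_set_subset hM hr f a)).trans
            (measure_iUnion_fintype_le _ _)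
      _ = _ := by
          simp [(measurePreserving_signFlip κ _).measure_preimage hTm.nullMeasurableSet]
  rw [mul_comm, mul_div_assoc', ENNReal.le_div_iff_mul_le
    (Or.inl (by rw [Ne, ENNReal.ofReal_eq_zero, not_le]; exact hlam))
    (Or.inl ENNReal.ofReal_ne_top)]
  calc _ ≤ (2 ^ d * muK d κ T) * (ENNReal.ofReal K * 2 ^ d * a) := by
        rw [hlam'] at hS ⊢
        gcongr
    _ = 2 ^ d * (ENNReal.ofReal K * 2 ^ d * (a * muK d κ T)) := by ring
    _ ≤ 2 ^ d * (ENNReal.ofReal K * 2 ^ d * (C * I)) := by gcongr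
    _ ≤ 2 ^ d * (ENNReal.ofReal K * 2 ^ d * ((C + 1) * I)) := by gcongr; exact le_self_add
    _ = _ := by
        rw [ENNReal.ofReal_mul (by positivity), ENNReal.ofReal_mul (by positivity),
          ENNReal.ofReal_mul hK.le, ENNReal.ofReal_pow zero_le_two, ENNReal.ofReal_ofNat,
          ENNReal.ofReal_add C.coe_nonneg zero_le_one, ENNReal.ofReal_coe_nnreal,
          ENNReal.ofReal_one]
        ring
end
end

section
/- Let W be a positive, locally μ_κ-integrable function on ℝ^d and let 1 < q < +∞. There exists a constant C > 0, depending only on κ_1,…,κ_d and q, such that for every measurable f, ∫_{ℝ^d} (M_κ^R f(y))^q W(y) dμ_κ(y) ≤ C ∫_{ℝ^d} |f(y)|^q M_κ^R W(y) dμ_κ(y). -/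
noncomputable section
open MeasureTheory Set Real
open scoped ENNReal NNReal

/-- The exponent-`p` power of an extended nonnegative number as an integral over its sublevels. -/
lemma rpow_eq_lintegral_lt {p : ℝ} (hp : 0 < p) (a : ℝ≥0∞) :
    a ^ p = ENNReal.ofReal p *
      ∫⁻ t in Ioi (0 : ℝ), if ENNReal.ofReal t < a then ENNReal.ofReal (t ^ (p - 1)) else 0 := by
  have key : ∀ x : ℝ, 0 ≤ x → ENNReal.ofReal x ^ p = ENNReal.ofReal p *
      ∫⁻ t in Ioi (0 : ℝ),
        if ENNReal.ofReal t < ENNReal.ofReal x then ENNReal.ofReal (t ^ (p - 1)) else 0 := by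
    intro x hx
    have h := lintegral_rpow_eq_lintegral_meas_lt_mul (Measure.dirac ())
      (f := fun _ => x) (Filter.Eventually.of_forall fun _ => hx) measurable_const.aemeasurable hp
    rw [lintegral_dirac, ← ENNReal.ofReal_rpow_of_nonneg hx hp.le] at h
    rw [h]
    congr 1
    refine setLIntegral_congr_fun measurableSet_Ioi fun t ht => ?_
    have ht' : (0 : ℝ) < t := ht
    by_cases hlt : t < x
    · simp [hlt, (ENNReal.ofReal_lt_ofReal_iff (ht'.trans hlt)).2 hlt]
    · have : ¬ ENNReal.ofReal t < ENNReal.ofReal x :=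
        not_lt.2 (ENNReal.ofReal_le_ofReal (not_lt.1 hlt))
      simp [hlt, this]
  rcases eq_or_ne a ∞ with rfl | ha
  · rw [ENNReal.top_rpow_of_pos hp]
    symm
    refine ENNReal.eq_top_of_forall_nnreal_le fun r => ?_
    have h := key ((r : ℝ) ^ (p⁻¹)) (by positivity)
    rw [ENNReal.ofReal_rpow_of_nonneg (by positivity) hp.le, ← Real.rpow_mul r.coe_nonneg,
      inv_mul_cancel₀ hp.ne', Real.rpow_one, ENNReal.ofReal_coe_nnreal] at h
    rw [h]
    gcongr with t
    split_ifs <;> simp_all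
  · rw [← ENNReal.ofReal_toReal ha]
    exact key _ ENNReal.toReal_nonneg

section AbstractMaximal

variable {X ι : Type*} [MeasurableSpace X]

/-- The uncentered maximal function attached to a family of sets. -/
def famMax (μ : Measure X) (B : ι → Set X) (f : X → ℝ≥0∞) (x : X) : ℝ≥0∞ :=
  ⨆ i, (B i).indicator (fun _ => (μ (B i))⁻¹ * ∫⁻ y in B i, f y ∂μ) x

/-- The maximal function of a measure `ω`, averaged over enlarged sets `B'`. -/
def famMaxMeas (μ ω : Measure X) (B B' : ι → Set X) (x : X) : ℝ≥0∞ :=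
  ⨆ i, (B i).indicator (fun _ => (μ (B i))⁻¹ * ω (B' i)) x

lemma measurable_famMax [Countable ι] (μ : Measure X) {B : ι → Set X}
    (hB : ∀ i, MeasurableSet (B i)) (f : X → ℝ≥0∞) : Measurable (famMax μ B f) :=
  Measurable.iSup fun i => measurable_const.indicator (hB i)

lemma measurable_famMaxMeas [Countable ι] (μ ω : Measure X) {B : ι → Set X}
    (hB : ∀ i, MeasurableSet (B i)) (B' : ι → Set X) : Measurable (famMaxMeas μ ω B B') :=
  Measurable.iSup fun i => measurable_const.indicator (hB i)

/-- The Vitali covering property for finite subfamilies. -/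
def VitaliFamilyProp (B B' : ι → Set X) : Prop :=
  ∀ s : Finset ι, ∃ u ⊆ s, (u : Set ι).PairwiseDisjoint B ∧ ⋃ i ∈ s, B i ⊆ ⋃ i ∈ u, B' i

lemma famMax_weak_type [Countable ι] (μ ω : Measure X) {B B' : ι → Set X}
    (hB : ∀ i, MeasurableSet (B i)) (hV : VitaliFamilyProp B B')
    {f : X → ℝ≥0∞} (hf : Measurable f) (s : ℝ≥0∞) :
    s * ω {x | s < famMax μ B f x} ≤ ∫⁻ x, f x * famMaxMeas μ ω B B' x ∂μ := by
  classical
  set T : Set ι := {i | s < (μ (B i))⁻¹ * ∫⁻ y in B i, f y ∂μ} with hT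
  have hset : {x | s < famMax μ B f x} ⊆ ⋃ i : T, B i := by
    intro x hx
    obtain ⟨i, hi⟩ := lt_iSup_iff.1 (show s < famMax μ B f x from hx)
    by_cases hxi : x ∈ B i
    · rw [indicator_of_mem hxi] at hi
      exact mem_iUnion.2 ⟨⟨i, hi⟩, hxi⟩
    · simp [indicator_of_notMem hxi] at hi
  have hpt : ∀ i ∈ T, s * ω (B' i) ≤ ∫⁻ x in B i, f x * famMaxMeas μ ω B B' x ∂μ := by
    intro i hi
    calc s * ω (B' i) ≤ ((μ (B i))⁻¹ * ∫⁻ y in B i, f y ∂μ) * ω (B' i) :=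
          mul_le_mul_left (le_of_lt hi) _
      _ = (∫⁻ y in B i, f y ∂μ) * ((μ (B i))⁻¹ * ω (B' i)) := by ring
      _ = ∫⁻ y in B i, f y * ((μ (B i))⁻¹ * ω (B' i)) ∂μ := (lintegral_mul_const _ hf).symm
      _ ≤ _ := by
          refine setLIntegral_mono' (hB i) fun y hy => mul_le_mul_right ?_ _
          refine le_trans ?_ (le_iSup _ i)
          rw [indicator_of_mem hy]
  have hfin : ∀ t : Finset T, s * ω (⋃ i ∈ t, B (i : ι)) ≤
      ∫⁻ x, f x * famMaxMeas μ ω B B' x ∂μ := by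
    intro t
    obtain ⟨u, hut, hdis, hcov⟩ := hV (t.map (Function.Embedding.subtype _))
    have huT : ∀ i ∈ u, i ∈ T := by
      intro i hi
      obtain ⟨j, -, rfl⟩ := Finset.mem_map.1 (hut hi)
      exact j.2
    calc s * ω (⋃ i ∈ t, B (i : ι)) ≤ s * ω (⋃ i ∈ u, B' i) := by
          gcongr
          refine subset_trans ?_ hcov
          intro x hx
          simp only [mem_iUnion] at hx ⊢
          obtain ⟨i, hi, hx⟩ := hx
          exact ⟨i, Finset.mem_map_of_mem _ hi, hx⟩
      _ ≤ s * ∑ i ∈ u, ω (B' i) := by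
          gcongr
          exact measure_biUnion_finset_le _ _
      _ = ∑ i ∈ u, s * ω (B' i) := Finset.mul_sum _ _ _
      _ ≤ ∑ i ∈ u, ∫⁻ x in B i, f x * famMaxMeas μ ω B B' x ∂μ :=
          Finset.sum_le_sum fun i hi => hpt i (huT i hi)
      _ = ∫⁻ x in ⋃ i ∈ u, B i, f x * famMaxMeas μ ω B B' x ∂μ :=
          (lintegral_biUnion_finset hdis (fun i _ => hB i) _).symm
      _ ≤ _ := setLIntegral_le_lintegral _ _
  have hsup : ω (⋃ i : T, B i) = ⨆ t : Finset T, ω (⋃ i ∈ t, B (i : ι)) := by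
    rw [iUnion_eq_iUnion_finset]
    exact Directed.measure_iUnion (directed_of_isDirected_le fun t t' h =>
      biUnion_subset_biUnion_left h)
  calc s * ω {x | s < famMax μ B f x} ≤ s * ω (⋃ i : T, B i) := by gcongr
    _ = ⨆ t : Finset T, s * ω (⋃ i ∈ t, B (i : ι)) := by rw [hsup, ENNReal.mul_iSup]
    _ ≤ _ := iSup_le hfin

lemma famMax_le_truncate_add (μ : Measure X) (B : ι → Set X)
    {f : X → ℝ≥0∞} (s : ℝ≥0∞) (x : X) :
    famMax μ B f x ≤ famMax μ B (fun y => if s < f y then f y else 0) x + s := by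
  refine iSup_le fun i => ?_
  by_cases hx : x ∈ B i
  · refine le_trans ?_ (add_le_add_left (le_iSup _ i) s)
    rw [indicator_of_mem hx, indicator_of_mem hx]
    calc (μ (B i))⁻¹ * ∫⁻ y in B i, f y ∂μ
        ≤ (μ (B i))⁻¹ * ∫⁻ y in B i, ((if s < f y then f y else 0) + s) ∂μ := by
          gcongr with y
          split_ifs with h
          · exact le_self_add
          · simpa using h
      _ = (μ (B i))⁻¹ * (∫⁻ y in B i, (if s < f y then f y else 0) ∂μ) +
            (μ (B i))⁻¹ * μ (B i) * s := by
          rw [lintegral_add_right _ measurable_const]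
          simp only [lintegral_const, Measure.restrict_apply_univ]
          ring
      _ ≤ _ := by
          gcongr
          exact mul_le_of_le_one_left' (ENNReal.inv_mul_le_one _)
  · rw [indicator_of_notMem hx]
    exact bot_le

/-- The strong-type weighted inequality, from the weak-type one by truncation. -/
lemma famMax_strong_type [Countable ι] (μ ω : Measure X) [SFinite μ] [SFinite ω]
    {B B' : ι → Set X} (hB : ∀ i, MeasurableSet (B i)) (hV : VitaliFamilyProp B B')
    {f : X → ℝ≥0∞} (hf : Measurable f) {q : ℝ} (hq : 1 < q) :
    ∫⁻ x, famMax μ B f x ^ q ∂ω ≤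
      ENNReal.ofReal q * (2 * (ENNReal.ofReal (q - 1))⁻¹ * 2 ^ (q - 1)) *
        ∫⁻ x, f x ^ q * famMaxMeas μ ω B B' x ∂μ := by
  set G := famMax μ B f with hG
  set H := famMaxMeas μ ω B B' with hH
  have hGm : Measurable G := measurable_famMax μ hB f
  have hHm : Measurable H := measurable_famMaxMeas μ ω hB B'
  have hq1 : 0 < q - 1 := by linarith
  have hlevel : ∀ t : ℝ, 0 < t → ENNReal.ofReal t * ω {x | ENNReal.ofReal t < G x} ≤
      2 * ∫⁻ x, (if ENNReal.ofReal t < 2 * f x then f x else 0) * H x ∂μ := by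
    intro t ht
    set s : ℝ≥0∞ := ENNReal.ofReal t / 2 with hs
    have hst : ENNReal.ofReal t = s + s := (ENNReal.add_halves _).symm
    have hs' : s ≠ ∞ := by simp [hs, ENNReal.div_eq_top]
    have hiff : ∀ x, (ENNReal.ofReal t < 2 * f x) = (s < f x) := by
      intro x
      rw [hs, ENNReal.div_lt_iff (by simp) (by simp), mul_comm]
    simp only [hiff]
    have hmeas : Measurable fun y => if s < f y then f y else 0 :=
      Measurable.ite (measurableSet_lt measurable_const hf) hf measurable_const
    have hw := famMax_weak_type μ ω hB hV hmeas s
    calc ENNReal.ofReal t * ω {x | ENNReal.ofReal t < G x}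
        ≤ ENNReal.ofReal t *
            ω {x | s < famMax μ B (fun y => if s < f y then f y else 0) x} := by
          refine mul_le_mul_right (measure_mono fun x (hx : ENNReal.ofReal t < G x) => ?_) _
          rw [hst] at hx
          have := hx.trans_le (famMax_le_truncate_add μ B s x)
          exact (ENNReal.add_lt_add_iff_right hs').1 this
      _ = 2 * (s * ω {x | s < famMax μ B (fun y => if s < f y then f y else 0) x}) := by
          rw [hst]
          ring
      _ ≤ _ := by gcongr
  have hswap1 : ∫⁻ x, G x ^ q ∂ω = ENNReal.ofReal q * ∫⁻ t in Ioi (0 : ℝ),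
      ENNReal.ofReal (t ^ (q - 1)) * ω {x | ENNReal.ofReal t < G x} := by
    simp only [rpow_eq_lintegral_lt (zero_lt_one.trans hq)]
    have hm : Measurable fun p : X × ℝ =>
        if ENNReal.ofReal p.2 < G p.1 then ENNReal.ofReal (p.2 ^ (q - 1)) else 0 := by
      refine Measurable.ite (measurableSet_lt (by fun_prop) (hGm.comp measurable_fst)) ?_
        measurable_const
      fun_prop
    rw [lintegral_const_mul _ hm.lintegral_prod_right', lintegral_lintegral_swap hm.aemeasurable]
    congr 1
    refine lintegral_congr fun t => ?_
    rw [← lintegral_indicator_const (measurableSet_lt measurable_const hGm)]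
    refine lintegral_congr fun x => ?_
    simp [indicator]
  have hswap2 : ∫⁻ t in Ioi (0 : ℝ), ENNReal.ofReal (t ^ (q - 1 - 1)) *
        (∫⁻ x, (if ENNReal.ofReal t < 2 * f x then f x else 0) * H x ∂μ) =
      (ENNReal.ofReal (q - 1))⁻¹ * 2 ^ (q - 1) * ∫⁻ x, f x ^ q * H x ∂μ := by
    have hm : Measurable fun p : ℝ × X => ENNReal.ofReal (p.1 ^ (q - 1 - 1)) *
        ((if ENNReal.ofReal p.1 < 2 * f p.2 then f p.2 else 0) * H p.2) := by
      refine Measurable.mul (by fun_prop) (Measurable.mul ?_ (hHm.comp measurable_snd))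
      exact Measurable.ite (measurableSet_lt (by fun_prop)
        ((hf.comp measurable_snd).const_mul 2)) (hf.comp measurable_snd) measurable_const
    calc _ = ∫⁻ t in Ioi (0 : ℝ), (∫⁻ x, ENNReal.ofReal (t ^ (q - 1 - 1)) *
          ((if ENNReal.ofReal t < 2 * f x then f x else 0) * H x) ∂μ) := by
          refine lintegral_congr fun t => ?_
          rw [lintegral_const_mul]
          exact (Measurable.ite (measurableSet_lt measurable_const (hf.const_mul 2)) hf
            measurable_const).mul hHm
      _ = ∫⁻ x, (∫⁻ t in Ioi (0 : ℝ), ENNReal.ofReal (t ^ (q - 1 - 1)) *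
          ((if ENNReal.ofReal t < 2 * f x then f x else 0) * H x)) ∂μ :=
          lintegral_lintegral_swap hm.aemeasurable
      _ = ∫⁻ x, (ENNReal.ofReal (q - 1))⁻¹ * 2 ^ (q - 1) * (f x ^ q * H x) ∂μ := by
          refine lintegral_congr fun x => ?_
          have h1 := rpow_eq_lintegral_lt hq1 (2 * f x)
          have h2 : ∫⁻ t in Ioi (0 : ℝ), (if ENNReal.ofReal t < 2 * f x then
              ENNReal.ofReal (t ^ (q - 1 - 1)) else 0) =
              (ENNReal.ofReal (q - 1))⁻¹ * (2 * f x) ^ (q - 1) := by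
            rw [h1, ← mul_assoc, ENNReal.inv_mul_cancel (by simpa using hq1) (by simp), one_mul]
          have h3 : f x ^ q = f x ^ (q - 1) * f x := by
            conv_lhs => rw [show q = (q - 1) + 1 by ring]
            rw [ENNReal.rpow_add_of_nonneg _ _ hq1.le zero_le_one, ENNReal.rpow_one]
          calc _ = ∫⁻ t in Ioi (0 : ℝ), (if ENNReal.ofReal t < 2 * f x then
                ENNReal.ofReal (t ^ (q - 1 - 1)) else 0) * (f x * H x) := by
                refine lintegral_congr fun t => ?_
                split_ifs <;> simp
            _ = _ := by
                rw [lintegral_mul_const, h2, ENNReal.mul_rpow_of_nonneg _ _ hq1.le, h3]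
                · ring
                · exact Measurable.ite (measurableSet_lt (by fun_prop) measurable_const)
                    (by fun_prop) measurable_const
      _ = _ := lintegral_const_mul _ ((hf.pow_const q).mul hHm)
  calc ∫⁻ x, G x ^ q ∂ω = _ := hswap1
    _ ≤ ENNReal.ofReal q * ∫⁻ t in Ioi (0 : ℝ), 2 * (ENNReal.ofReal (t ^ (q - 1 - 1)) *
        (∫⁻ x, (if ENNReal.ofReal t < 2 * f x then f x else 0) * H x ∂μ)) := by
        gcongr ENNReal.ofReal q * ?_
        refine setLIntegral_mono' measurableSet_Ioi fun t ht => ?_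
        have ht' : (0 : ℝ) < t := ht
        have hpow : t ^ (q - 1) = t ^ (q - 1 - 1) * t := by
          rw [← Real.rpow_add_one ht'.ne']
          ring_nf
        rw [hpow, ENNReal.ofReal_mul (by positivity), mul_assoc]
        calc _ ≤ ENNReal.ofReal (t ^ (q - 1 - 1)) * (2 * _) := mul_le_mul_right (hlevel t ht') _
          _ = _ := by ring
    _ = _ := by
        rw [lintegral_const_mul' _ _ (by simp), hswap2]
        ring

end AbstractMaximal

/-- The set of points whose coordinatewise absolute values are within `r` of those of `z`. -/
def absBox (d : ℕ) (z : Fin d → ℝ) (r : ℝ) : Set (Fin d → ℝ) :=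
  {y | ∀ j, |(|y j| - |z j|)| ≤ r}

lemma measurableSet_absBox (d : ℕ) (z : Fin d → ℝ) (r : ℝ) : MeasurableSet (absBox d z r) := by
  simp only [absBox, ← Real.norm_eq_abs, ofPred_forall]
  exact MeasurableSet.iInter fun j => measurableSet_le (by fun_prop) measurable_const

lemma absBox_eq_preimage {d : ℕ} (z : Fin d → ℝ) {r : ℝ} (hr : 0 ≤ r) :
    absBox d z r =
      (fun (y : Fin d → ℝ) j => |y j|) ⁻¹' Metric.closedBall (fun j => |z j|) r := by
  ext y
  simp [absBox, dist_pi_le_iff hr, Real.dist_eq]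

/-- Doubling constant of `muK`, comparing a rectangle with an eightfold enlarged box. -/
def doublingConst (d : ℕ) (κ : Fin d → ℝ) : ℝ := ∏ j, (64 * 16 ^ (2 * κ j))

lemma doublingConst_pos (d : ℕ) (κ : Fin d → ℝ) : 0 < doublingConst d κ :=
  Finset.prod_pos fun _ _ => by positivity

lemma muK_absBox_le {d : ℕ} {κ : Fin d → ℝ} (hκ : ∀ j, 0 ≤ κ j) (z : Fin d → ℝ) {r : ℝ}
    (hr : 0 < r) :
    muK d κ (absBox d z (8 * r)) ≤
      ENNReal.ofReal (doublingConst d κ) * muK d κ (Rset d z r) := by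
  have hupper : muK d κ (absBox d z (8 * r)) ≤
      ENNReal.ofReal (∏ j, (|z j| + 8 * r) ^ (2 * κ j)) * ENNReal.ofReal (∏ _j : Fin d, 32 * r) := by
    rw [muK, withDensity_apply _ (measurableSet_absBox _ _ _)]
    calc _ ≤ ∫⁻ _ in absBox d z (8 * r), ENNReal.ofReal (∏ j, (|z j| + 8 * r) ^ (2 * κ j)) := by
          refine setLIntegral_mono' (measurableSet_absBox _ _ _) fun y hy => ?_
          refine ENNReal.ofReal_le_ofReal (Finset.prod_le_prod (fun j _ => by positivity)
            fun j _ => ?_)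
          refine Real.rpow_le_rpow (abs_nonneg _) ?_ (by linarith [hκ j])
          have := (abs_le.1 (hy j)).2
          linarith
      _ = ENNReal.ofReal (∏ j, (|z j| + 8 * r) ^ (2 * κ j)) * volume (absBox d z (8 * r)) := by
          rw [setLIntegral_const]
      _ ≤ _ := by
          gcongr
          have : absBox d z (8 * r) = univ.pi fun j => {t : ℝ | |(|t| - |z j|)| ≤ 8 * r} := by
            ext y; simp [absBox]
          rw [this, volume_pi_pi, ENNReal.ofReal_prod_of_nonneg fun _ _ => by positivity]
          refine Finset.prod_le_prod' fun j _ => ?_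
          calc volume {t : ℝ | |(|t| - |z j|)| ≤ 8 * r}
              ≤ volume (Icc (|z j| - 8 * r) (|z j| + 8 * r) ∪
                  Icc (-|z j| - 8 * r) (-|z j| + 8 * r)) := by
                refine measure_mono fun t ht => ?_
                obtain ⟨h1, h2⟩ := abs_le.1 (show |(|t| - |z j|)| ≤ 8 * r from ht)
                rcases abs_cases t with ⟨h, _⟩ | ⟨h, _⟩
                · left; constructor <;> linarith
                · right; constructor <;> linarith
            _ ≤ _ := measure_union_le _ _
            _ = _ := by
                rw [Real.volume_Icc, Real.volume_Icc, ← ENNReal.ofReal_add (by linarith)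
                  (by linarith)]
                ring_nf
  have hlower : ENNReal.ofReal (∏ j, (|z j| + r / 2) ^ (2 * κ j)) *
      ENNReal.ofReal (∏ _j : Fin d, r / 2) ≤ muK d κ (Rset d z r) := by
    set S : Set (Fin d → ℝ) := univ.pi fun j => Ico (|z j| + r / 2) (|z j| + r) with hS
    have hSm : MeasurableSet S := MeasurableSet.univ_pi fun j => measurableSet_Ico
    have hsub : S ⊆ Rset d z r := by
      refine pi_mono fun j _ => Ico_subset_Ico_left (max_le ?_ ?_)
      · positivity
      · linarith
    refine le_trans ?_ (measure_mono hsub)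
    rw [muK, withDensity_apply _ hSm]
    have hvol : volume S = ENNReal.ofReal (∏ _j : Fin d, r / 2) := by
      rw [hS, volume_pi_pi, ENNReal.ofReal_prod_of_nonneg fun _ _ => by positivity]
      refine Finset.prod_congr rfl fun j _ => ?_
      rw [Real.volume_Ico]
      ring_nf
    rw [← hvol, ← setLIntegral_const]
    refine setLIntegral_mono' hSm fun y hy => ?_
    refine ENNReal.ofReal_le_ofReal (Finset.prod_le_prod (fun j _ => by positivity) fun j _ => ?_)
    refine Real.rpow_le_rpow (by positivity) ?_ (by linarith [hκ j])
    exact ((hy j (mem_univ j)).1).trans (le_abs_self _)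
  refine hupper.trans (le_trans ?_ (mul_le_mul_right hlower _))
  rw [← ENNReal.ofReal_mul (Finset.prod_nonneg fun _ _ => by positivity),
    ← ENNReal.ofReal_mul (Finset.prod_nonneg fun _ _ => by positivity),
    ← ENNReal.ofReal_mul (doublingConst_pos d κ).le]
  refine ENNReal.ofReal_le_ofReal ?_
  rw [doublingConst, ← Finset.prod_mul_distrib, ← Finset.prod_mul_distrib,
    ← Finset.prod_mul_distrib]
  refine Finset.prod_le_prod (fun j _ => by positivity) fun j _ => ?_
  have h : (|z j| + 8 * r) ^ (2 * κ j) ≤ 16 ^ (2 * κ j) * (|z j| + r / 2) ^ (2 * κ j) := by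
    rw [← Real.mul_rpow (by norm_num) (by positivity)]
    refine Real.rpow_le_rpow (by positivity) ?_ (by linarith [hκ j])
    linarith [abs_nonneg (z j)]
  nlinarith

lemma inv_le_mul_inv_of_le {D a b : ℝ≥0∞} (hD : D ≠ 0) (hD' : D ≠ ∞) (h : a ≤ D * b) :
    b⁻¹ ≤ D * a⁻¹ := by
  calc b⁻¹ = D * (D * b)⁻¹ := by
        rw [ENNReal.mul_inv (Or.inl hD) (Or.inl hD'), ← mul_assoc,
          ENNReal.mul_inv_cancel hD hD', one_mul]
    _ ≤ D * a⁻¹ := by gcongr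

lemma Rset_subset_absBox {d : ℕ} (z : Fin d → ℝ) (r : ℝ) :
    {y | (fun j => |y j|) ∈ Rset d z r} ⊆ absBox d z r := by
  intro y hy j
  obtain ⟨h1, h2⟩ := hy j (mem_univ j)
  have h3 := (le_max_right _ _).trans h1
  simp only at h2 h3
  rw [abs_le]
  constructor <;> linarith

lemma absBox_subset_Rset {d : ℕ} (z : Fin d → ℝ) {r s : ℝ} (h : r < s) :
    absBox d z r ⊆ {y | (fun j => |y j|) ∈ Rset d z s} := by
  intro y hy j _
  obtain ⟨h1, h2⟩ := abs_le.1 (hy j)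
  refine ⟨max_le (abs_nonneg _) ?_, ?_⟩ <;> simp only <;> linarith

lemma absBox_subset_absBox {d : ℕ} {z w : Fin d → ℝ} {r s t : ℝ} (hw : w ∈ absBox d z s)
    (h : r + s ≤ t) : absBox d z r ⊆ absBox d w t := by
  intro y hy j
  have h1 := abs_le.1 (hw j)
  have h2 := abs_le.1 (hy j)
  rw [abs_le]
  constructor <;> linarith

lemma mem_absBox_comm {d : ℕ} {z w : Fin d → ℝ} {r : ℝ} :
    w ∈ absBox d z r ↔ z ∈ absBox d w r := by
  simp only [absBox, mem_ofPred_eq, abs_sub_comm]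

lemma self_mem_absBox {d : ℕ} (z : Fin d → ℝ) {r : ℝ} (hr : 0 ≤ r) : z ∈ absBox d z r := by
  intro j
  simpa using hr

lemma Rset_subset_absBox_self {d : ℕ} (z : Fin d → ℝ) (r : ℝ) : Rset d z r ⊆ absBox d z r := by
  intro y hy
  refine Rset_subset_absBox z r ?_
  intro j hj
  have h := hy j hj
  simp only [abs_of_nonneg ((le_max_left _ _).trans h.1)]
  exact h

/-- Index set of boxes with rational center and positive rational radius. -/
abbrev RatBox (d : ℕ) : Type := (Fin d → ℚ) × {s : ℚ // 0 < s}

/-- The box of a rational index, dilated by the factor `a`. -/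
def ratBox (d : ℕ) (a : ℝ) (i : RatBox d) : Set (Fin d → ℝ) :=
  absBox d (fun j => (i.1 j : ℝ)) (a * (i.2 : ℚ))

lemma ratBox_vitali (d : ℕ) : VitaliFamilyProp (ratBox d 1) (ratBox d 5) := by
  classical
  intro s
  have hpos : ∀ i : RatBox d, (0 : ℝ) < ((i.2 : ℚ) : ℝ) := fun i => by exact_mod_cast i.2.2
  obtain ⟨R, hR⟩ := (s.image fun i : RatBox d => ((i.2 : ℚ) : ℝ)).bddAbove
  obtain ⟨u, hus, hdis, hcov⟩ := Vitali.exists_disjoint_subfamily_covering_enlargement_closedBall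
    (s : Set (RatBox d)) (fun i j => |(i.1 j : ℝ)|) (fun i => ((i.2 : ℚ) : ℝ)) R
    (fun i hi => hR (Finset.mem_coe.2 (Finset.mem_image_of_mem _ hi))) 5 (by norm_num)
  have heq : ∀ (a : ℝ), 0 ≤ a → ∀ i : RatBox d, ratBox d a i =
      (fun (y : Fin d → ℝ) j => |y j|) ⁻¹'
        Metric.closedBall (fun j => |(i.1 j : ℝ)|) (a * ((i.2 : ℚ) : ℝ)) := fun a ha i =>
    absBox_eq_preimage _ (mul_nonneg ha (hpos i).le)
  have hfin : u.Finite := s.finite_toSet.subset hus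
  refine ⟨hfin.toFinset, by simpa using hus, ?_, ?_⟩
  · intro i hi j hj hij
    have := hdis (by simpa using hi) (by simpa using hj) hij
    simp only [Function.onFun, heq 1 zero_le_one, one_mul]
    exact Disjoint.preimage _ this
  · refine iUnion₂_subset fun i hi => ?_
    obtain ⟨b, hb, hib⟩ := hcov i hi
    refine subset_trans ?_ (subset_biUnion_of_mem (u := fun i => ratBox d 5 i)
      (show b ∈ (hfin.toFinset) by simpa using hb))
    rw [heq 1 zero_le_one, heq 5 (by norm_num), one_mul]
    exact preimage_mono hib

lemma MR_le_famMax {d : ℕ} {κ : Fin d → ℝ} (hκ : ∀ j, 0 ≤ κ j) (f : (Fin d → ℝ) → ℝ)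
    (x : Fin d → ℝ) :
    MR d κ f x ≤ ENNReal.ofReal (doublingConst d κ) *
      famMax (muK d κ) (ratBox d 1) (fun y => ENNReal.ofReal |f y|) x := by
  have hD : ENNReal.ofReal (doublingConst d κ) ≠ 0 := by
    simpa using doublingConst_pos d κ
  refine iSup₂_le fun r hr => ?_
  have hc : ∀ j, ∃ c : ℚ, |x j| < c ∧ (c : ℝ) < |x j| + r := fun j =>
    exists_rat_btwn (by linarith)
  choose c hc1 hc2 using hc
  obtain ⟨s, hs1, hs2⟩ := exists_rat_btwn (show 2 * r < 3 * r by linarith)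
  have hs0 : 0 < s := by
    have : (0 : ℝ) < s := by linarith
    exact_mod_cast this
  have hcx : (fun j => (c j : ℝ)) ∈ absBox d x r := by
    intro j
    have := abs_nonneg (x j)
    rw [abs_of_nonneg (show (0 : ℝ) ≤ c j by linarith [hc1 j]), abs_le]
    constructor <;> linarith [hc1 j, hc2 j]
  set i : RatBox d := (c, ⟨s, hs0⟩) with hi
  have hxi : x ∈ ratBox d 1 i :=
    absBox_subset_absBox (r := 0) hcx (by simp [hi]; linarith) (self_mem_absBox x le_rfl)
  have hsub : {y | (fun j => |y j|) ∈ Rset d x r} ⊆ ratBox d 1 i :=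
    (Rset_subset_absBox x r).trans (absBox_subset_absBox hcx (by simp [hi]; linarith))
  have hsup : ratBox d 1 i ⊆ absBox d x (8 * r) :=
    absBox_subset_absBox (mem_absBox_comm.1 hcx) (by simp [hi]; linarith)
  have hmu := inv_le_mul_inv_of_le hD ENNReal.ofReal_ne_top
    ((measure_mono hsup).trans (muK_absBox_le hκ x hr))
  calc (muK d κ (Rset d x r))⁻¹ *
        ∫⁻ y in {y | (fun j => |y j|) ∈ Rset d x r}, ENNReal.ofReal |f y| ∂(muK d κ)
      ≤ (ENNReal.ofReal (doublingConst d κ) * (muK d κ (ratBox d 1 i))⁻¹) *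
        ∫⁻ y in ratBox d 1 i, ENNReal.ofReal |f y| ∂(muK d κ) := by
        gcongr
    _ ≤ _ := by
        rw [mul_assoc]
        gcongr
        refine le_trans ?_ (le_iSup _ i)
        rw [indicator_of_mem hxi]

lemma famMaxMeas_le_MR {d : ℕ} {κ : Fin d → ℝ} (hκ : ∀ j, 0 ≤ κ j) (W : (Fin d → ℝ) → ℝ)
    (x : Fin d → ℝ) :
    famMaxMeas (muK d κ) ((muK d κ).withDensity fun y => ENNReal.ofReal (W y))
        (ratBox d 1) (ratBox d 5) x ≤
      ENNReal.ofReal (doublingConst d κ) * MR d κ W x := by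
  have hD : ENNReal.ofReal (doublingConst d κ) ≠ 0 := by
    simpa using doublingConst_pos d κ
  refine iSup_le fun i => ?_
  by_cases hx : x ∈ ratBox d 1 i
  swap
  · simp [indicator_of_notMem hx]
  rw [indicator_of_mem hx]
  set z : Fin d → ℝ := fun j => (i.1 j : ℝ) with hz
  set s : ℝ := ((i.2 : ℚ) : ℝ) with hs
  have hs0 : 0 < s := by
    rw [hs]
    exact_mod_cast i.2.2
  have hx' : x ∈ absBox d z s := by simpa [ratBox] using hx
  have hsub : ratBox d 5 i ⊆ {y | (fun j => |y j|) ∈ Rset d x (7 * s)} :=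
    (absBox_subset_absBox (t := 6 * s) hx' (by linarith)).trans
      (absBox_subset_Rset x (by linarith))
  have hsup : Rset d x (7 * s) ⊆ absBox d z (8 * s) :=
    (Rset_subset_absBox_self x _).trans
      (absBox_subset_absBox (mem_absBox_comm.1 hx') (by linarith))
  have hRle : muK d κ (Rset d z s) ≤ muK d κ (ratBox d 1 i) := by
    refine measure_mono ((Rset_subset_absBox_self z s).trans ?_)
    simp [ratBox, hz, hs]
  have hmu := inv_le_mul_inv_of_le hD ENNReal.ofReal_ne_top
    (((measure_mono hsup).trans (muK_absBox_le hκ z hs0)).trans (mul_le_mul_right hRle _))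
  have hB : MeasurableSet (ratBox d 5 i) := measurableSet_absBox _ _ _
  rw [withDensity_apply _ hB]
  calc (muK d κ (ratBox d 1 i))⁻¹ * ∫⁻ y in ratBox d 5 i, ENNReal.ofReal (W y) ∂(muK d κ)
      ≤ (ENNReal.ofReal (doublingConst d κ) * (muK d κ (Rset d x (7 * s)))⁻¹) *
        ∫⁻ y in {y | (fun j => |y j|) ∈ Rset d x (7 * s)}, ENNReal.ofReal |W y| ∂(muK d κ) := by
        refine mul_le_mul' hmu ?_
        refine (lintegral_mono_set hsub).trans (lintegral_mono fun y => ?_)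
        exact ENNReal.ofReal_le_ofReal (le_abs_self _)
    _ ≤ _ := by
        rw [mul_assoc]
        gcongr
        exact le_iSup₂_of_le (7 * s) (by linarith) le_rfl

/-- Weighted `L^q` inequality for `M_κ^R`. -/
theorem MR_weighted_Lq
    (d : ℕ) (hd : 1 ≤ d) (κ : Fin d → ℝ) (hκ : ∀ j, 0 ≤ κ j)
    (q : ℝ) (hq : 1 < q) :
    ∃ C : ℝ, 0 < C ∧ ∀ W : (Fin d → ℝ) → ℝ, (∀ x, 0 < W x) →
      LocallyIntegrable W (muK d κ) →
      ∀ f : (Fin d → ℝ) → ℝ, Measurable f →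
      ∫⁻ y, MR d κ f y ^ q * ENNReal.ofReal (W y) ∂(muK d κ) ≤
        ENNReal.ofReal C * ∫⁻ y, ENNReal.ofReal (|f y|) ^ q * MR d κ W y ∂(muK d κ) := by
  have hq0 : 0 < q := by linarith
  have hq1 : 0 < q - 1 := by linarith
  set D := ENNReal.ofReal (doublingConst d κ) with hD
  set A : ℝ≥0∞ := ENNReal.ofReal q * (2 * (ENNReal.ofReal (q - 1))⁻¹ * 2 ^ (q - 1)) with hA
  set K : ℝ≥0∞ := D ^ q * (A * D) with hK
  have hK_top : K ≠ ∞ := by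
    have h1 : (ENNReal.ofReal (q - 1))⁻¹ ≠ ∞ := by simpa using hq1
    have h2 : (2 : ℝ≥0∞) ^ (q - 1) ≠ ∞ := ENNReal.rpow_ne_top_of_nonneg hq1.le (by simp)
    have h3 : D ^ q ≠ ∞ := ENNReal.rpow_ne_top_of_nonneg hq0.le ENNReal.ofReal_ne_top
    have h4 : A ≠ ∞ := ENNReal.mul_ne_top ENNReal.ofReal_ne_top
      (ENNReal.mul_ne_top (ENNReal.mul_ne_top (by simp) h1) h2)
    exact ENNReal.mul_ne_top h3 (ENNReal.mul_ne_top h4 ENNReal.ofReal_ne_top)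
  refine ⟨K.toReal + 1, by positivity, fun W _ hW f hf => ?_⟩
  have : SFinite (muK d κ) := by unfold muK; infer_instance
  have hWm : AEMeasurable (fun y => ENNReal.ofReal (W y)) (muK d κ) :=
    hW.aestronglyMeasurable.aemeasurable.ennreal_ofReal
  set ω := (muK d κ).withDensity fun y => ENNReal.ofReal (W y) with hω
  have hB : ∀ i, MeasurableSet (ratBox d 1 i) := fun i => measurableSet_absBox _ _ _
  set F : (Fin d → ℝ) → ℝ≥0∞ := fun y => ENNReal.ofReal |f y| with hF
  have hFm : Measurable F := hf.abs.ennreal_ofReal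
  set G := famMax (muK d κ) (ratBox d 1) F with hG
  have hGm : Measurable fun y => G y ^ q := (measurable_famMax _ hB F).pow_const q
  calc ∫⁻ y, MR d κ f y ^ q * ENNReal.ofReal (W y) ∂(muK d κ)
      ≤ ∫⁻ y, D ^ q * (ENNReal.ofReal (W y) * G y ^ q) ∂(muK d κ) := by
        refine lintegral_mono fun y => ?_
        calc _ ≤ (D * G y) ^ q * ENNReal.ofReal (W y) := by
              gcongr
              exact MR_le_famMax hκ f y
          _ = _ := by
              rw [ENNReal.mul_rpow_of_nonneg _ _ hq0.le]
              ring
    _ = D ^ q * ∫⁻ y, G y ^ q ∂ω := by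
        rw [lintegral_const_mul' _ _ (ENNReal.rpow_ne_top_of_nonneg hq0.le ENNReal.ofReal_ne_top),
          hω, lintegral_withDensity_eq_lintegral_mul₀ hWm hGm.aemeasurable]
        rfl
    _ ≤ D ^ q * (A * ∫⁻ y, F y ^ q *
          famMaxMeas (muK d κ) ω (ratBox d 1) (ratBox d 5) y ∂(muK d κ)) := by
        gcongr
        exact famMax_strong_type _ _ hB (ratBox_vitali d) hFm hq
    _ ≤ D ^ q * (A * ∫⁻ y, D * (F y ^ q * MR d κ W y) ∂(muK d κ)) := by
        refine mul_le_mul_right (mul_le_mul_right (lintegral_mono fun y => ?_) _) _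
        calc _ ≤ F y ^ q * (D * MR d κ W y) := by
              gcongr
              exact famMaxMeas_le_MR hκ W y
          _ = _ := by ring
    _ = K * ∫⁻ y, F y ^ q * MR d κ W y ∂(muK d κ) := by
        rw [lintegral_const_mul' _ _ ENNReal.ofReal_ne_top, hK]
        ring
    _ ≤ _ := by
        gcongr
        rw [← ENNReal.ofReal_toReal hK_top]
        refine ENNReal.ofReal_le_ofReal ?_
        simp
end
end
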